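/- arXiv:2001.09123 — 7 statements merged into one kernel-verified Lean document; each statement's English description precedes it below -/
import Mathlib

section
/- Let n ≥ 2 be an integer and let p be the largest prime with p ≤ n. Then for every vector v ∈ ℝ^n with pairwise distinct coordinates whose coordinates do not sum to 0, and every hyperplane H ⊆ ℝ^n through the origin, the cardinality of H ∩ S_n·v is at most n!/p. -/
open Module

theorem card_level_le_finrank_ker {ι K V : Type*} [Fintype ι] [Field K] [AddCommGroup V]
    [Module K V] (B : Basis ι K V) (F : ι → ℝ) (N : V →ₗ[K] V)
    (hN : ∀ i, N (B i) ∈ Submodule.span K (B '' {j | F i < F j})) (b : ℝ) :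
    (Finset.univ.filter fun i => F i = b).card ≤ finrank K (LinearMap.ker N) := by
  classical
  have : FiniteDimensional K V := B.finiteDimensional_of_finite
  have key : ∀ P : ι → Prop, finrank K (Submodule.span K (B '' {j | P j})) =
      (Finset.univ.filter P).card := by
    intro P
    have h := finrank_span_eq_card (B.linearIndependent.comp (Subtype.val : {j // P j} → ι)
      Subtype.val_injective)
    rw [Set.range_comp, Subtype.range_coe_subtype, Fintype.card_subtype] at h
    exact h
  set W := Submodule.span K (B '' {j | b ≤ F j}) with hW
  set W' := Submodule.span K (B '' {j | b < F j}) with hW'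
  have hrange : LinearMap.range (N.domRestrict W) ≤ W' := by
    rw [LinearMap.range_domRestrict, hW, Submodule.map_span, Submodule.span_le]
    rintro _ ⟨_, ⟨i, hi, rfl⟩, rfl⟩
    have hsub : {j | F i < F j} ⊆ {j | b < F j} := by
      intro j hj
      exact lt_of_le_of_lt (Set.mem_ofPred_eq ▸ hi) hj
    exact Submodule.span_mono (Set.image_mono hsub) (hN i)
  have hker : finrank K (LinearMap.ker (N.domRestrict W)) ≤ finrank K (LinearMap.ker N) := by
    rw [← Submodule.finrank_map_subtype_eq]
    apply Submodule.finrank_mono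
    rintro _ ⟨x, hx, rfl⟩
    simpa using hx
  have hrn := LinearMap.finrank_range_add_finrank_ker (N.domRestrict W)
  have hr := Submodule.finrank_mono hrange
  have hcW : finrank K W = (Finset.univ.filter fun i => b ≤ F i).card := key _
  have hcW' : finrank K W' = (Finset.univ.filter fun i => b < F i).card := key _
  have hsplit : (Finset.univ.filter fun i => b ≤ F i).card =
      (Finset.univ.filter fun i => b < F i).card + (Finset.univ.filter fun i => F i = b).card := by
    rw [← Finset.card_union_of_disjoint, ← Finset.filter_or]
    · congr 1
      ext i
      simp [le_iff_lt_or_eq, eq_comm]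
    · rw [Finset.disjoint_filter]
      intro i _ h1 h2
      exact h1.ne' h2
  omega

section Translation

variable (p : ℕ) [Fact p.Prime]

/-- The cyclic shift of the standard basis of `(ZMod p) ^ p`. -/
noncomputable def cyclicShift : (Fin p → ZMod p) →ₗ[ZMod p] (Fin p → ZMod p) :=
  (Pi.basisFun (ZMod p) (Fin p)).constr (ZMod p) fun s => Pi.basisFun (ZMod p) (Fin p) (s + 1)

/-- The iterated differences of the first standard basis vector under the cyclic shift. -/
noncomputable def shiftDiff (j : ℕ) : Fin p → ZMod p :=
  ((cyclicShift p - 1) ^ j) (Pi.basisFun (ZMod p) (Fin p) 0)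

theorem cyclicShift_basisFun (s : Fin p) :
    cyclicShift p (Pi.basisFun (ZMod p) (Fin p) s) = Pi.basisFun (ZMod p) (Fin p) (s + 1) := by
  rw [cyclicShift, Basis.constr_basis]

theorem cyclicShift_pow_basisFun (j : ℕ) (s : Fin p) :
    (cyclicShift p ^ j) (Pi.basisFun (ZMod p) (Fin p) s) =
      Pi.basisFun (ZMod p) (Fin p) (s + j • 1) := by
  induction j with
  | zero => simp
  | succ j ih =>
    rw [pow_succ', Module.End.mul_apply, ih, cyclicShift_basisFun, succ_nsmul, add_assoc]

theorem cyclicShift_shiftDiff (j : ℕ) :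
    cyclicShift p (shiftDiff p j) = shiftDiff p j + shiftDiff p (j + 1) := by
  rw [shiftDiff, shiftDiff, pow_succ', Module.End.mul_apply, LinearMap.sub_apply,
    Module.End.one_apply]
  abel

theorem cyclicShift_pow_prime : cyclicShift p ^ p = 1 := by
  refine (Pi.basisFun (ZMod p) (Fin p)).ext fun s => ?_
  rw [cyclicShift_pow_basisFun, Module.End.one_apply]
  have h : p • (1 : Fin p) = 0 := by
    simpa using card_nsmul_eq_zero (G := Fin p) (x := 1)
  rw [h, add_zero]

theorem shiftDiff_prime : shiftDiff p p = 0 := by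
  have : CharP (Module.End (ZMod p) (Fin p → ZMod p)) p :=
    charP_of_injective_algebraMap (FaithfulSMul.algebraMap_injective (ZMod p) _) p
  rw [shiftDiff, sub_pow_char_of_commute _ (Commute.one_right _), cyclicShift_pow_prime]
  simp

theorem span_shiftDiff :
    ⊤ ≤ Submodule.span (ZMod p) (Set.range fun j : Fin p => shiftDiff p j) := by
  set W := Submodule.span (ZMod p) (Set.range fun j : Fin p => shiftDiff p j) with hW
  have hmem : ∀ j : ℕ, j ≤ p → shiftDiff p j ∈ W := by
    intro j hj
    rcases hj.lt_or_eq with h | rfl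
    · exact Submodule.subset_span ⟨⟨j, h⟩, rfl⟩
    · rw [shiftDiff_prime]
      exact W.zero_mem
  have hinv : ∀ x ∈ W, cyclicShift p x ∈ W := by
    suffices W ≤ W.comap (cyclicShift p) from fun x hx => this hx
    rw [hW, Submodule.span_le]
    rintro _ ⟨j, rfl⟩
    change cyclicShift p (shiftDiff p j) ∈ W
    rw [cyclicShift_shiftDiff]
    exact W.add_mem (hmem _ j.2.le) (hmem _ j.2)
  have hpow : ∀ j : ℕ, (cyclicShift p ^ j) (Pi.basisFun (ZMod p) (Fin p) 0) ∈ W := by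
    intro j
    induction j with
    | zero => simpa [shiftDiff] using hmem 0 (Nat.zero_le _)
    | succ j ih =>
      rw [pow_succ', Module.End.mul_apply]
      exact hinv _ ih
  rw [← (Pi.basisFun (ZMod p) (Fin p)).span_eq, Submodule.span_le]
  rintro _ ⟨s, rfl⟩
  have h := hpow s
  have hs : s.val • (1 : Fin p) = s := by
    open Fin.CommRing in
    rw [nsmul_one, Fin.cast_val_eq_self]
  rwa [cyclicShift_pow_basisFun, zero_add, hs] at h

/-- The iterated differences `shiftDiff p j` for `j < p` form a basis. -/
noncomputable def shiftDiffBasis : Basis (Fin p) (ZMod p) (Fin p → ZMod p) :=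
  basisOfTopLeSpanOfCardEqFinrank _ (span_shiftDiff p) (by simp)

theorem shiftDiffBasis_apply (j : Fin p) : shiftDiffBasis p j = shiftDiff p j := by
  simp [shiftDiffBasis]

open Set.powersetCard in
theorem exists_perm_comp_eq_ofFinEmbEquiv_symm {α : Type*} [LinearOrder α] {k : ℕ}
    (t : Fin k → α) (ht : Function.Injective t) :
    ∃ π : Equiv.Perm (Fin k), ∃ s : Set.powersetCard α k,
      t ∘ π = ofFinEmbEquiv.symm s ∧ s.val = Finset.univ.map ⟨t, ht⟩ := by
  have hmono : StrictMono (t ∘ Tuple.sort t) :=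
    (Tuple.monotone_sort t).strictMono_of_injective (ht.comp (Equiv.injective _))
  refine ⟨Tuple.sort t, ofFinEmbEquiv (OrderEmbedding.ofStrictMono _ hmono), ?_, ?_⟩
  · simp
  · ext x
    rw [mem_coe_iff, mem_ofFinEmbEquiv_iff_mem_range]
    simp only [OrderEmbedding.coe_ofStrictMono, Set.mem_range, Function.comp_apply,
      Finset.mem_map, Finset.mem_univ, true_and, Function.Embedding.coeFn_mk]
    exact ((Tuple.sort t).surjective.exists (p := fun y => t y = x)).symm

theorem finrank_ker_map_cyclicShift_le {k : ℕ} (hk : 0 < k) (hkp : k < p) :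
    finrank (ZMod p) (LinearMap.ker (exteriorPower.map k (cyclicShift p) - 1)) ≤
      Nat.card {s : Set.powersetCard (Fin p) k // ∑ x ∈ s.val, x = 0} := by
  classical
  have : Finite (Set.powersetCard (Fin p) k) := inferInstance
  let e := Pi.basisFun (ZMod p) (Fin p)
  let G := exteriorPower.map k (cyclicShift p)
  let Z := {s : Set.powersetCard (Fin p) k // ∑ x ∈ s.val, x = 0}
  let _ : Fintype Z := Fintype.ofFinite Z
  let U := Submodule.span (ZMod p) (Set.range fun s : Z => e.exteriorPower k s.1)
  have hU : finrank (ZMod p) U ≤ Nat.card Z := by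
    rw [Nat.card_eq_fintype_card]
    exact finrank_range_le_card _
  have hshift : ∀ (j : ℕ) (t : Fin k → Fin p),
      exteriorPower.ιMulti (ZMod p) k (fun i => e (t i + j • 1)) -
        exteriorPower.ιMulti (ZMod p) k (fun i => e (t i)) ∈ LinearMap.range (G - 1) := by
    intro j t
    induction j with
    | zero => simp
    | succ j ih =>
      refine (Submodule.sub_mem_iff_left _ ih).mp ?_
      refine ⟨exteriorPower.ιMulti (ZMod p) k (fun i => e (t i + j • 1)), ?_⟩
      rw [LinearMap.sub_apply, Module.End.one_apply, exteriorPower.map_apply_ιMulti,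
        sub_sub_sub_cancel_right]
      congr 2
      ext1 i
      simp only [Function.comp_apply, e, cyclicShift_basisFun, succ_nsmul, add_assoc]
  have hsup : LinearMap.range (G - 1) ⊔ U = ⊤ := by
    rw [eq_top_iff, ← (e.exteriorPower k).span_eq, Submodule.span_le]
    rintro _ ⟨s, rfl⟩
    let t : Fin k → Fin p := Set.powersetCard.ofFinEmbEquiv.symm s
    have ht : Function.Injective t := (Set.powersetCard.ofFinEmbEquiv.symm s).injective
    have hcop : (Nat.card (Fin p)).Coprime k := by
      rw [Nat.card_eq_fintype_card, Fintype.card_fin]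
      exact (Nat.coprime_of_lt_prime hk.ne' hkp Fact.out)
    obtain ⟨c, hc⟩ := (nsmulCoprime hcop).surjective (-∑ i, t i)
    have hc' : c.val • (1 : Fin p) = c := by
      open Fin.CommRing in
      rw [nsmul_one, Fin.cast_val_eq_self]
    have ht' : Function.Injective fun i => t i + c.val • (1 : Fin p) :=
      (add_left_injective _).comp ht
    obtain ⟨π, s', hs', hval⟩ := exists_perm_comp_eq_ofFinEmbEquiv_symm _ ht'
    have hsum : ∑ x ∈ s'.val, x = 0 := by
      rw [hval, Finset.sum_map]
      simp only [Function.Embedding.coeFn_mk, hc', Finset.sum_add_distrib, Finset.sum_const,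
        Finset.card_univ, Fintype.card_fin]
      rw [nsmulCoprime_apply] at hc
      rw [hc, add_neg_cancel]
    have hmem : exteriorPower.ιMulti (ZMod p) k (fun i => e (t i + c.val • 1)) ∈ U := by
      have h : e.exteriorPower k s' ∈ U := Submodule.subset_span ⟨⟨s', hsum⟩, rfl⟩
      rw [exteriorPower.basis_apply, exteriorPower.ιMulti_family, ← hs'] at h
      have hperm := (exteriorPower.ιMulti (ZMod p) k).map_perm
        (fun i => e (t i + c.val • (1 : Fin p))) π
      change exteriorPower.ιMulti (ZMod p) k
        ((fun i => e (t i + c.val • (1 : Fin p))) ∘ π) ∈ U at h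
      rw [hperm] at h
      rcases Int.units_eq_one_or (Equiv.Perm.sign π) with hπ | hπ
      · simpa [hπ] using h
      · simpa [hπ] using h
    have heq : e.exteriorPower k s = exteriorPower.ιMulti (ZMod p) k (fun i => e (t i)) := by
      rw [exteriorPower.basis_apply, exteriorPower.ιMulti_family]
      rfl
    rw [heq, SetLike.mem_coe]
    have h1 := Submodule.mem_sup_left (T := U) (hshift c.val t)
    have h2 := Submodule.mem_sup_right (S := LinearMap.range (G - 1)) hmem
    exact (Submodule.sub_mem_iff_right _ h2).mp h1
  have h1 := Submodule.finrank_add_le_finrank_add_finrank (LinearMap.range (G - 1)) U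
  rw [hsup, finrank_top] at h1
  have h2 := LinearMap.finrank_range_add_finrank_ker (G - 1)
  change finrank (ZMod p) (LinearMap.ker (G - 1)) ≤ Nat.card Z
  omega

theorem prime_mul_card_sum_eq_zero_le {k : ℕ} (hk : 0 < k) (hkp : k < p) :
    p * Nat.card {s : Set.powersetCard (Fin p) k // ∑ x ∈ s.val, x = 0} ≤
      p.choose k := by
  have : Finite (Set.powersetCard (Fin p) k) := inferInstance
  let Z := {s : Set.powersetCard (Fin p) k // ∑ x ∈ s.val, x = 0}
  have hcop : (Nat.card (Fin p)).Coprime k := by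
    rw [Nat.card_eq_fintype_card, Fintype.card_fin]
    exact (Nat.coprime_of_lt_prime hk.ne' hkp Fact.out)
  let φ : Fin p × Z → Set.powersetCard (Fin p) k := fun x =>
    Set.powersetCard.map k (Equiv.addRight x.1).toEmbedding x.2.1
  have hφ : ∀ x, ∑ y ∈ (φ x).val, y = k • x.1 := by
    rintro ⟨j, s, hs⟩
    simp only [φ, Set.powersetCard.val_map, Finset.sum_map, Equiv.coe_toEmbedding,
      Equiv.coe_addRight, Finset.sum_add_distrib, Finset.sum_const]
    rw [hs, zero_add, Set.powersetCard.card_eq]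
  have hinj : Function.Injective φ := by
    rintro ⟨j, s, hs⟩ ⟨j', s', hs'⟩ h
    have hj : j = j' := by
      apply (nsmulCoprime hcop).injective
      rw [nsmulCoprime_apply, nsmulCoprime_apply, ← hφ ⟨j, s, hs⟩, h, hφ]
    subst hj
    have hss : s = s' := by
      apply Subtype.ext
      have := congrArg Subtype.val h
      simpa [φ] using this
    subst hss
    rfl
  have := Nat.card_le_card_of_injective φ hinj
  rw [Nat.card_prod, Set.powersetCard.card] at this
  simpa using this

open Set.powersetCard in
theorem map_cyclicShift_sub_one_mem_span {k : ℕ} (F : Set.powersetCard (Fin p) k → ℝ)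
    (hF : ∀ s s', s ≠ s' → (∀ i, ofFinEmbEquiv.symm s i ≤ ofFinEmbEquiv.symm s' i) → F s < F s')
    (s : Set.powersetCard (Fin p) k) :
    (exteriorPower.map k (cyclicShift p) - 1) ((shiftDiffBasis p).exteriorPower k s) ∈
      Submodule.span (ZMod p) ((shiftDiffBasis p).exteriorPower k '' {s' | F s < F s'}) := by
  classical
  let t : Fin k → Fin p := ofFinEmbEquiv.symm s
  have ht : StrictMono t := (ofFinEmbEquiv.symm s).strictMono
  have hB : ∀ s' : Set.powersetCard (Fin p) k, (shiftDiffBasis p).exteriorPower k s' =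
      exteriorPower.ιMulti (ZMod p) k (fun i => shiftDiff p (ofFinEmbEquiv.symm s' i : Fin p)) := by
    intro s'
    rw [exteriorPower.basis_apply, exteriorPower.ιMulti_family]
    congr 1
    ext1 i
    rw [Function.comp_apply, shiftDiffBasis_apply]
  have hexp : (exteriorPower.map k (cyclicShift p) - 1) ((shiftDiffBasis p).exteriorPower k s) =
      ∑ R ∈ Finset.univ.erase Finset.univ, exteriorPower.ιMulti (ZMod p) k
        ((R : Finset (Fin k)).piecewise (fun i => shiftDiff p (t i))
          (fun i => shiftDiff p (t i + 1))) := by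
    rw [LinearMap.sub_apply, Module.End.one_apply, hB s, exteriorPower.map_apply_ιMulti]
    have h := (exteriorPower.ιMulti (ZMod p) k (M := Fin p → ZMod p)).toMultilinearMap.map_add_univ
      (fun i => shiftDiff p (t i)) (fun i => shiftDiff p (t i + 1))
    rw [← Finset.add_sum_erase _ _ (Finset.mem_univ Finset.univ), Finset.piecewise_univ] at h
    simp only [AlternatingMap.coe_multilinearMap] at h
    rw [sub_eq_iff_eq_add', ← h]
    congr 1
    ext1 i
    exact cyclicShift_shiftDiff p _
  rw [hexp]
  refine Submodule.sum_mem _ fun R hR => ?_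
  have hR' : R ≠ Finset.univ := Finset.ne_of_mem_erase hR
  let u : Fin k → ℕ := fun i => if i ∈ R then t i else t i + 1
  have hu : R.piecewise (fun i => shiftDiff p (t i)) (fun i => shiftDiff p (t i + 1)) =
      fun i => shiftDiff p (u i) := by
    ext1 i
    by_cases h : i ∈ R <;> simp [u, h]
  have htu : ∀ i, (t i : ℕ) ≤ u i := fun i => by simp only [u]; split_ifs <;> omega
  have hut : ∀ i, u i ≤ t i + 1 := fun i => by simp only [u]; split_ifs <;> omega
  rw [hu]
  by_cases hlt : ∀ i, u i < p
  · let w : Fin k → Fin p := fun i => ⟨u i, hlt i⟩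
    by_cases hw : Function.Injective w
    · have hwm : StrictMono w := by
        refine Monotone.strictMono_of_injective (fun i j hij => ?_) hw
        rcases hij.lt_or_eq with h | rfl
        · have h1 : (t i : ℕ) < t j := ht h
          have h2 := hut i
          have h3 := htu j
          exact Fin.mk_le_mk.mpr (by omega)
        · exact le_rfl
      let s' := ofFinEmbEquiv (OrderEmbedding.ofStrictMono w hwm)
      have hs' : ∀ i, ofFinEmbEquiv.symm s' i = w i := by simp [s']
      refine Submodule.subset_span ⟨s', hF s s' ?_ fun i => ?_, ?_⟩
      · rintro hss
        obtain ⟨i, hi⟩ : ∃ i, i ∉ R := by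
          by_contra! h
          exact hR' (Finset.eq_univ_iff_forall.mpr h)
        have h1 : t i = w i := by rw [← hs', ← hss]
        have h2 := congrArg Fin.val h1
        simp [w, u, hi] at h2
      · rw [hs']
        exact htu i
      · rw [hB]
        simp only [hs', w]
    · have : exteriorPower.ιMulti (ZMod p) k (fun i => shiftDiff p (u i)) = 0 := by
        refine AlternatingMap.map_eq_zero_of_not_injective _ _ fun h => hw fun i j hij => ?_
        exact h (congrArg (fun x : Fin p => shiftDiff p x) hij)
      rw [this]
      exact Submodule.zero_mem _
  · push Not at hlt
    obtain ⟨i, hi⟩ := hlt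
    have h1 := hut i
    have h2 := (t i).2
    have h3 : u i = p := by omega
    rw [AlternatingMap.map_coord_zero _ i (by rw [h3, shiftDiff_prime])]
    exact Submodule.zero_mem _

open Set.powersetCard in
theorem card_level_mul_prime_le_choose {k : ℕ} (hk : 0 < k) (hkp : k < p)
    (F : Set.powersetCard (Fin p) k → ℝ)
    (hF : ∀ s s', s ≠ s' → (∀ i, ofFinEmbEquiv.symm s i ≤ ofFinEmbEquiv.symm s' i) → F s < F s')
    (b : ℝ) :
    Nat.card {s // F s = b} * p ≤ p.choose k := by
  classical
  let _ : Fintype (Set.powersetCard (Fin p) k) := Fintype.ofFinite _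
  have h1 := card_level_le_finrank_ker ((shiftDiffBasis p).exteriorPower k) F
    (exteriorPower.map k (cyclicShift p) - 1) (map_cyclicShift_sub_one_mem_span p F hF) b
  have h2 := finrank_ker_map_cyclicShift_le p hk hkp
  have h3 := prime_mul_card_sum_eq_zero_le p hk hkp
  rw [Nat.card_eq_fintype_card, Fintype.card_subtype, mul_comm]
  exact (Nat.mul_le_mul_left p (h1.trans h2)).trans h3

end Translation

theorem inr_le_inr_of_inl_le_inl {α : Type*} [LinearOrder α] {k m : ℕ}
    (w w' : Fin k ⊕ Fin m ≃ α) (hw : StrictMono (w ∘ Sum.inr)) (hw' : StrictMono (w' ∘ Sum.inr))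
    (h : ∀ i, w (Sum.inl i) ≤ w' (Sum.inl i)) (j : Fin m) :
    w' (Sum.inr j) ≤ w (Sum.inr j) := by
  classical
  have : Fintype α := Fintype.ofEquiv _ w
  by_contra! hlt
  set x := w (Sum.inr j) with hx
  have key : ∀ u : Fin k ⊕ Fin m ≃ α, (Finset.univ.filter fun i => u (Sum.inl i) ≤ x).card +
      (Finset.univ.filter fun i => u (Sum.inr i) ≤ x).card =
      (Finset.univ.filter fun y => y ≤ x).card := by
    intro u
    simp only [Finset.card_filter]
    rw [← Equiv.sum_comp u, Fintype.sum_sum_type]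
  have h1 : (Finset.univ.filter fun i => w' (Sum.inl i) ≤ x).card ≤
      (Finset.univ.filter fun i => w (Sum.inl i) ≤ x).card :=
    Finset.card_le_card (Finset.monotone_filter_right _ fun i _ hi => (h i).trans hi)
  have h2 : (Finset.univ.filter fun i => w' (Sum.inr i) ≤ x).card <
      (Finset.univ.filter fun i => w (Sum.inr i) ≤ x).card := by
    refine Finset.card_lt_card (Finset.ssubset_iff_of_subset ?_ |>.mpr ⟨j, ?_, ?_⟩)
    · intro i hi
      rw [Finset.mem_filter_univ] at hi ⊢
      have hij : i < j := hw'.lt_iff_lt.mp (hi.trans_lt hlt)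
      exact (hw hij).le
    · simp [hx]
    · simpa using hlt
  have h3 := key w
  have h4 := key w'
  omega

theorem sum_mul_lt_sum_mul_of_inl_le_inl {α : Type*} [LinearOrder α] {k m : ℕ}
    (w w' : Fin k ⊕ Fin m ≃ α) (hw : StrictMono (w ∘ Sum.inr)) (hw' : StrictMono (w' ∘ Sum.inr))
    (h : ∀ i, w (Sum.inl i) ≤ w' (Sum.inl i)) (hne : ∃ i, w (Sum.inl i) ≠ w' (Sum.inl i))
    (v : α → ℝ) (hv : StrictMono v) (a : Fin k ⊕ Fin m → ℝ) (θ : ℝ)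
    (hl : ∀ i, θ < a (Sum.inl i)) (hr : ∀ j, a (Sum.inr j) ≤ θ)
    (π : Equiv.Perm (Fin k)) (ρ : Equiv.Perm (Fin m)) :
    ∑ x, a x * v (w (Equiv.sumCongr π ρ x)) < ∑ x, a x * v (w' (Equiv.sumCongr π ρ x)) := by
  have : Fintype α := Fintype.ofEquiv _ w
  have h0 : ∑ x, v (w (Equiv.sumCongr π ρ x)) = ∑ x, v (w' (Equiv.sumCongr π ρ x)) := by
    rw [Equiv.sum_comp (Equiv.sumCongr π ρ) (fun x => v (w x)), Equiv.sum_comp w v,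
      Equiv.sum_comp (Equiv.sumCongr π ρ) (fun x => v (w' x)), Equiv.sum_comp w' v]
  suffices ∑ x, (a x - θ) * v (w (Equiv.sumCongr π ρ x)) <
      ∑ x, (a x - θ) * v (w' (Equiv.sumCongr π ρ x)) by
    simp only [sub_mul, Finset.sum_sub_distrib, ← Finset.mul_sum, h0] at this
    linarith
  apply Finset.sum_lt_sum
  · rintro (i | j) -
    · exact mul_le_mul_of_nonneg_left (hv.monotone (h _)) (sub_nonneg.mpr (hl i).le)
    · exact mul_le_mul_of_nonpos_left
        (hv.monotone (inr_le_inr_of_inl_le_inl w w' hw hw' h _)) (sub_nonpos.mpr (hr j))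
  · obtain ⟨i, hi⟩ := hne
    refine ⟨Sum.inl (π.symm i), Finset.mem_univ _, ?_⟩
    refine mul_lt_mul_of_pos_left (hv ?_) (sub_pos.mpr (hl _))
    simpa using lt_of_le_of_ne (h i) hi

theorem card_equiv_level_mul_prime_le {p k m : ℕ} (hp : p.Prime) (hkm : k + m = p)
    (hk : 0 < k) (hm : 0 < m) (v : Fin p → ℝ) (hv : StrictMono v) (a : Fin k ⊕ Fin m → ℝ) (θ : ℝ)
    (hl : ∀ i, θ < a (Sum.inl i)) (hr : ∀ j, a (Sum.inr j) ≤ θ) (b : ℝ) :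
    Nat.card {σ : Fin k ⊕ Fin m ≃ Fin p // ∑ x, a x * v (σ x) = b} * p ≤ p.factorial := by
  classical
  have : Fact p.Prime := ⟨hp⟩
  have hcompl : ∀ s : Set.powersetCard (Fin p) k, s.valᶜ.card = m := by
    intro s
    rw [Finset.card_compl, Fintype.card_fin, Set.powersetCard.card_eq]
    omega
  let w : Set.powersetCard (Fin p) k → (Fin k ⊕ Fin m ≃ Fin p) := fun s =>
    finSumEquivOfFinset (Set.powersetCard.card_eq s) (hcompl s)
  have hwl : ∀ s i, w s (Sum.inl i) = Set.powersetCard.ofFinEmbEquiv.symm s i := fun s i =>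
    finSumEquivOfFinset_inl _ _ i
  have hwr : ∀ s, StrictMono (w s ∘ Sum.inr) := by
    intro s i j hij
    simp only [w, Function.comp_apply, finSumEquivOfFinset_inr]
    exact (Finset.orderEmbOfFin _ _).strictMono hij
  let F : Equiv.Perm (Fin k) × Equiv.Perm (Fin m) → Set.powersetCard (Fin p) k → ℝ :=
    fun u s => ∑ x, a x * v (w s (Equiv.sumCongr u.1 u.2 x))
  have hF : ∀ u, Nat.card {s // F u s = b} * p ≤ p.choose k := by
    intro u
    refine card_level_mul_prime_le_choose p hk (by omega) (F u) (fun s s' hne hle => ?_) b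
    refine sum_mul_lt_sum_mul_of_inl_le_inl (w s) (w s') (hwr s) (hwr s') (fun i => ?_) ?_
      v hv a θ hl hr u.1 u.2
    · rw [hwl, hwl]
      exact hle i
    · by_contra! heq
      refine hne (Set.powersetCard.ofFinEmbEquiv.symm.injective (DFunLike.ext _ _ fun i => ?_))
      rw [← hwl, ← hwl, heq]
  let Φ : (Σ u, {s // F u s = b}) → {σ : Fin k ⊕ Fin m ≃ Fin p // ∑ x, a x * v (σ x) = b} :=
    fun y => ⟨(Equiv.sumCongr y.1.1 y.1.2).trans (w y.2.1), y.2.2⟩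
  have hΦ : Function.Surjective Φ := by
    rintro ⟨σ, hσ⟩
    let s : Set.powersetCard (Fin p) k :=
      Set.powersetCard.ofFinEmb k (Fin p) (Function.Embedding.inl.trans σ.toEmbedding)
    have hmaps : Set.MapsTo (σ.trans (w s).symm) (Set.range Sum.inl) (Set.range Sum.inl) := by
      rintro _ ⟨i, rfl⟩
      have hi : σ (Sum.inl i) ∈ s := by
        rw [Set.powersetCard.mem_ofFinEmb_iff_mem_range]
        exact ⟨i, rfl⟩
      rw [← Set.powersetCard.mem_range_ofFinEmbEquiv_symm_iff_mem] at hi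
      obtain ⟨j, hj⟩ := hi
      refine ⟨j, ?_⟩
      rw [Equiv.trans_apply, Equiv.eq_symm_apply, hwl, hj]
    obtain ⟨u, hu⟩ := Equiv.Perm.mem_sumCongrHom_range_of_perm_mapsTo_inl hmaps
    have hσ' : (Equiv.sumCongr u.1 u.2).trans (w s) = σ := by
      have hu' : Equiv.sumCongr u.1 u.2 = σ.trans (w s).symm := hu
      rw [hu', Equiv.trans_assoc, Equiv.symm_trans_self, Equiv.trans_refl]
    refine ⟨⟨u, s, ?_⟩, Subtype.ext hσ'⟩
    rw [← hσ, ← hσ']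
    rfl
  calc _ ≤ Nat.card (Σ u, {s // F u s = b}) * p :=
        Nat.mul_le_mul_right p (Nat.card_le_card_of_surjective Φ hΦ)
    _ = ∑ u, Nat.card {s // F u s = b} * p := by rw [Nat.card_sigma, Finset.sum_mul]
    _ ≤ ∑ _u : Equiv.Perm (Fin k) × Equiv.Perm (Fin m), p.choose k :=
        Finset.sum_le_sum fun u _ => hF u
    _ = p.factorial := by
      rw [Finset.sum_const, Finset.card_univ, Fintype.card_prod, Fintype.card_perm,
        Fintype.card_perm, Fintype.card_fin, Fintype.card_fin,
        ← Nat.choose_mul_factorial_mul_factorial (show k ≤ p by omega), smul_eq_mul,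
        show p - k = m by omega]
      ring

theorem card_perm_level_mul_prime_le {p : ℕ} (hp : p.Prime) (v : Fin p → ℝ)
    (hv : Function.Injective v) (a : Fin p → ℝ) (ha : ∃ i j, a i ≠ a j) (b : ℝ) :
    Nat.card {σ : Equiv.Perm (Fin p) // ∑ x, a x * v (σ x) = b} * p ≤ p.factorial := by
  classical
  obtain ⟨i, j, hij⟩ : ∃ i j, a i < a j := by
    obtain ⟨i, j, h⟩ := ha
    exact h.lt_or_gt.elim (fun h => ⟨i, j, h⟩) fun h => ⟨j, i, h⟩
  let A := Finset.univ.filter fun x => a i < a x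
  have hA : 0 < A.card := Finset.card_pos.mpr ⟨j, by simpa [A] using hij⟩
  have hA' : 0 < Aᶜ.card := Finset.card_pos.mpr ⟨i, by simp [A]⟩
  let q : Fin A.card ⊕ Fin Aᶜ.card ≃ Fin p := finSumEquivOfFinset rfl rfl
  have hql : ∀ x, q (Sum.inl x) ∈ A := fun x => by
    rw [finSumEquivOfFinset_inl]
    exact Finset.orderEmbOfFin_mem _ _ x
  have hqr : ∀ x, q (Sum.inr x) ∈ Aᶜ := fun x => by
    rw [finSumEquivOfFinset_inr]
    exact Finset.orderEmbOfFin_mem _ _ x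
  let τ := Tuple.sort v
  have hmono : StrictMono (v ∘ τ) :=
    (Tuple.monotone_sort v).strictMono_of_injective (hv.comp τ.injective)
  have h := card_equiv_level_mul_prime_le hp
    (by rw [Finset.card_add_card_compl, Fintype.card_fin]) hA hA' (v ∘ τ) hmono (a ∘ q) (a i)
    (fun x => (Finset.mem_filter_univ (q (Sum.inl x))).mp (hql x))
    (fun x => not_lt.mp fun h => Finset.mem_compl.mp (hqr x) ((Finset.mem_filter_univ _).mpr h)) b
  refine (Nat.mul_le_mul_right p ?_).trans h
  refine Nat.card_le_card_of_injective (fun σ => ⟨q.trans (σ.1.trans τ.symm), ?_⟩) ?_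
  · have hσ := σ.2
    rw [← Equiv.sum_comp q] at hσ
    simpa using hσ
  · intro σ σ' hσ
    ext1
    ext1 x
    have := congrArg (fun u => τ (u.1 (q.symm x))) hσ
    simpa using this

theorem card_perm_level_mul_prime_le_factorial {n p : ℕ} (hp : p.Prime) (hpn : p ≤ n)
    (v : Fin n → ℝ) (hv : Function.Injective v) (a : Fin n → ℝ) (ha : ∃ i j, a i ≠ a j) (b : ℝ) :
    Nat.card {σ : Equiv.Perm (Fin n) // ∑ x, a x * v (σ x) = b} * p ≤ n.factorial := by
  classical
  obtain ⟨i, j, hij⟩ := ha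
  obtain ⟨P, hP, hcard⟩ := Finset.exists_superset_card_eq (s := {i, j}) (n := p)
    (Finset.card_le_two.trans hp.two_le) (by simpa using hpn)
  let f : Fin p ↪ Fin n := (P.orderEmbOfFin hcard).toEmbedding
  have hf : ∀ x ∈ P, ∃ y, f y = x := by
    intro x hx
    have : x ∈ Set.range (P.orderEmbOfFin hcard) := by simpa using hx
    exact this
  obtain ⟨i', hi'⟩ := hf i (hP (by simp))
  obtain ⟨j', hj'⟩ := hf j (hP (by simp))
  let emb : Equiv.Perm (Fin p) → Equiv.Perm (Fin n) := fun h => h.viaFintypeEmbedding f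
  let good : Equiv.Perm (Fin n) → Prop := fun σ => ∑ x, a x * v (σ x) = b
  have hcoset : ∀ σ : Equiv.Perm (Fin n),
      (Finset.univ.filter fun h => good (σ * emb h)).card * p ≤ p.factorial := by
    intro σ
    let c := ∑ x ∈ (Finset.univ.map f)ᶜ, a x * v (σ x)
    have hsplit : ∀ h, ∑ x, a x * v ((σ * emb h) x) = ∑ y, a (f y) * v (σ (f (h y))) + c := by
      intro h
      rw [← Finset.sum_add_sum_compl (Finset.univ.map f), Finset.sum_map]
      congr 1
      · refine Finset.sum_congr rfl fun y _ => ?_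
        rw [Equiv.Perm.mul_apply, Equiv.Perm.viaFintypeEmbedding_apply_image]
      · refine Finset.sum_congr rfl fun x hx => ?_
        rw [Equiv.Perm.mul_apply, Equiv.Perm.viaFintypeEmbedding_apply_notMem_range]
        simpa using hx
    have h := card_perm_level_mul_prime_le hp (fun y => v (σ (f y)))
      (hv.comp (σ.injective.comp f.injective)) (fun y => a (f y))
      ⟨i', j', by rwa [hi', hj']⟩ (b - c)
    rw [Nat.card_eq_fintype_card, Fintype.card_subtype] at h
    simpa only [good, hsplit, ← eq_sub_iff_add_eq] using h
  have hdouble : ∑ σ, (Finset.univ.filter fun h => good (σ * emb h)).card =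
      p.factorial * (Finset.univ.filter good).card := by
    simp only [Finset.card_filter]
    rw [Finset.sum_comm]
    have : ∀ h, ∑ σ, (if good (σ * emb h) then 1 else 0) = ∑ σ, if good σ then 1 else 0 :=
      fun h => Equiv.sum_comp (Equiv.mulRight (emb h)) fun σ => if good σ then 1 else 0
    simp only [this, Finset.sum_const, Finset.card_univ, Fintype.card_perm, Fintype.card_fin,
      smul_eq_mul]
  rw [Nat.card_eq_fintype_card, Fintype.card_subtype]
  refine Nat.le_of_mul_le_mul_left ?_ p.factorial_pos
  calc _ = ∑ σ, (Finset.univ.filter fun h => good (σ * emb h)).card * p := by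
        rw [← Finset.sum_mul, hdouble, mul_assoc]
    _ ≤ ∑ _σ : Equiv.Perm (Fin n), p.factorial := Finset.sum_le_sum fun σ _ => hcoset σ
    _ = p.factorial * n.factorial := by
      simp [Fintype.card_perm, mul_comm]

/-- Let `n ≥ 2` and let `p` be the largest prime with `p ≤ n`. Then for every
vector `v ∈ ℝ^n` with pairwise distinct coordinates whose coordinates do not sum to `0`, and
every hyperplane through the origin `H = {x | ∑ i, a i * x i = 0}` (with `a ≠ 0`), the
cardinality of `H ∩ Sₙ·v` is at most `n!/p`. -/
theorem stmt0 (n p : ℕ) (hn : 2 ≤ n) (hp : p.Prime) (hpn : p ≤ n)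
    (hpmax : ∀ q : ℕ, q.Prime → q ≤ n → q ≤ p)
    (v : Fin n → ℝ) (hv : ∀ i j : Fin n, i ≠ j → v i ≠ v j)
    (hsum : ∑ i, v i ≠ 0)
    (a : Fin n → ℝ) (ha : a ≠ 0) :
    ((({x : Fin n → ℝ | ∑ i, a i * x i = 0} ∩
        {w : Fin n → ℝ | ∃ σ : Equiv.Perm (Fin n), w = fun i => v (σ⁻¹ i)}).ncard : ℝ))
      ≤ (n.factorial : ℝ) / (p : ℝ) := by
  classical
  have hv' : Function.Injective v := fun i j h => by_contra fun hij => hv i j hij h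
  by_cases hconst : ∃ i j, a i ≠ a j
  · have h := card_perm_level_mul_prime_le_factorial hp hpn v hv' a hconst 0
    rw [le_div_iff₀ (by exact_mod_cast hp.pos)]
    refine le_trans ?_ (Nat.cast_le.mpr h)
    rw [Nat.cast_mul]
    refine mul_le_mul_of_nonneg_right (Nat.cast_le.mpr ?_) (Nat.cast_nonneg p)
    let Φ : {σ : Equiv.Perm (Fin n) // ∑ x, a x * v (σ x) = 0} → (Fin n → ℝ) :=
      fun σ i => v (σ.1 i)
    refine (Set.ncard_le_ncard (t := Set.range Φ) ?_ (Set.finite_range Φ)).trans ?_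
    · rintro _ ⟨hx, σ, rfl⟩
      exact ⟨⟨σ⁻¹, hx⟩, rfl⟩
    · rw [← Set.image_univ]
      exact (Set.ncard_image_le Set.finite_univ).trans (Set.ncard_univ _).le
  · push Not at hconst
    have hempty : {x : Fin n → ℝ | ∑ i, a i * x i = 0} ∩
        {w : Fin n → ℝ | ∃ σ : Equiv.Perm (Fin n), w = fun i => v (σ⁻¹ i)} = ∅ := by
      rw [Set.eq_empty_iff_forall_notMem]
      rintro _ ⟨hx, σ, rfl⟩
      obtain ⟨i, hi⟩ := Function.ne_iff.mp ha
      have hx' : ∑ j, a j * v (σ⁻¹ j) = 0 := hx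
      rw [Finset.sum_congr rfl fun j _ => by rw [hconst j i], ← Finset.mul_sum,
        Equiv.sum_comp σ⁻¹ v] at hx'
      exact (mul_ne_zero hi hsum) hx'
    rw [hempty, Set.ncard_empty, Nat.cast_zero]
    positivity
end

section
/- Let n ≥ 3 be a prime. Then (a) for every v ∈ ℝ^n with pairwise distinct coordinates whose coordinates do not sum to 0 and every hyperplane H ⊆ ℝ^n through the origin, |H ∩ S_n·v| ≤ (n−1)!; and (b) for every such v there exists a hyperplane H through the origin with |H ∩ S_n·v| = (n−1)!. In particular, the maximum of |H ∩ S_n·v| over all such v and all hyperplanes H through the origin equals (n−1)!. -/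
open Equiv Finset in
/-- If a permutation of a finite type raises a real function outside a set `W`, then the level
sets of the function have at most `#W` elements. -/
theorem card_level_le_of_perm {X : Type*} [Fintype X] (Φ : Perm X) (H : X → ℝ) (W : Finset X)
    (hW : ∀ x, x ∉ W → H x < H (Φ x)) (c : ℝ) :
    (univ.filter fun x => H x = c).card ≤ W.card := by
  classical
  set D := univ.filter fun x => c ≤ H x with hD
  set D' := univ.filter fun x => c < H x with hD'
  have hsplit : (univ.filter fun x => H x = c).card + D'.card = D.card := by
    rw [← card_union_of_disjoint]
    · congr 1
      ext x
      simp only [hD, hD', mem_union, mem_filter, mem_univ, true_and]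
      rw [le_iff_lt_or_eq, or_comm, eq_comm]
    · rw [disjoint_filter]
      intro x _ h h'
      exact absurd h h'.ne'
  have hle : (D \ W).card ≤ D'.card := by
    refine card_le_card_of_injOn Φ ?_ Φ.injective.injOn
    intro x hx
    simp only [hD, coe_sdiff, Set.mem_sdiff, mem_coe, mem_filter, mem_univ, true_and] at hx
    simpa [hD'] using hx.1.trans_lt (hW x hx.2)
  have := le_card_sdiff W D
  omega

section ExclusionProcess

open Finset Equiv

variable (p k : ℕ) [Fact p.Prime]

/-- The sum over the coordinates `j` of the operators shifting the `j`-th variable by one. -/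
noncomputable def sumShift : Module.End (ZMod p) ((Fin k → ZMod p) → ZMod p) :=
  ∑ j : Fin k, LinearMap.funLeft (ZMod p) (ZMod p) fun x => x + Pi.single j 1

theorem sumShift_apply (f : (Fin k → ZMod p) → ZMod p) (x : Fin k → ZMod p) :
    sumShift p k f x = ∑ j, f (x + Pi.single j 1) := by
  simp [sumShift, LinearMap.sum_apply, LinearMap.funLeft_apply]

theorem funLeft_add_pow (y : Fin k → ZMod p) (m : ℕ) :
    (LinearMap.funLeft (ZMod p) (ZMod p) fun x : Fin k → ZMod p => x + y) ^ m =
      LinearMap.funLeft (ZMod p) (ZMod p) fun x => x + m • y := by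
  induction m with
  | zero => ext; simp [LinearMap.funLeft_apply]
  | succ m ih =>
    rw [pow_succ, ih]
    refine LinearMap.ext fun f => funext fun x => ?_
    simp [LinearMap.funLeft_apply, add_mul, add_assoc]

theorem sumShift_pow : sumShift p k ^ p = (k : Module.End (ZMod p) ((Fin k → ZMod p) → ZMod p)) := by
  have : CharP (Module.End (ZMod p) ((Fin k → ZMod p) → ZMod p)) p :=
    Module.charP_end ⟨fun _ => 1, by
      rw [eq_bot_iff]
      intro a ha
      rw [Ideal.mem_torsionOf_iff] at ha
      simpa using congrFun ha 0⟩
  have key : ∀ s : Finset (Fin k),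
      (∑ j ∈ s, LinearMap.funLeft (ZMod p) (ZMod p)
        fun x : Fin k → ZMod p => x + Pi.single j 1) ^ p =
      (s.card : Module.End (ZMod p) ((Fin k → ZMod p) → ZMod p)) := by
    intro s
    induction s using Finset.induction_on with
    | empty => simp [(Fact.out : p.Prime).ne_zero]
    | insert j s hj ih =>
      rw [sum_insert hj, add_pow_char_of_commute p, ih, funLeft_add_pow, card_insert_of_notMem hj,
        Nat.cast_add, Nat.cast_one, add_comm]
      · congr 1
        refine LinearMap.ext fun f => funext fun x => ?_
        have hp : p • (Pi.single j 1 : Fin k → ZMod p) = 0 := by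
          funext i
          rw [Pi.smul_apply, nsmul_eq_mul, CharP.cast_eq_zero, zero_mul, Pi.zero_apply]
        rw [LinearMap.funLeft_apply, hp, add_zero, Module.End.one_apply]
      · refine Commute.sum_right _ _ _ fun i _ => ?_
        refine LinearMap.ext fun f => funext fun x => ?_
        simp [LinearMap.funLeft_apply, add_right_comm]
  rw [sumShift, key univ, card_fin]

theorem sumShift_injective (hk : (k : ZMod p) ≠ 0) : Function.Injective (sumShift p k) := by
  rw [injective_iff_map_eq_zero]
  intro f hf
  have h : (sumShift p k ^ p) f = 0 := by
    obtain ⟨m, hm⟩ := Nat.exists_eq_succ_of_ne_zero (Fact.out : p.Prime).ne_zero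
    generalize sumShift p k = T at hf ⊢
    have hT : T ^ p = T ^ m * T := by rw [← pow_succ, ← Nat.succ_eq_add_one, ← hm]
    rw [hT, Module.End.mul_apply, hf, map_zero]
  rw [sumShift_pow, Module.End.natCast_apply] at h
  funext x
  have := congrFun h x
  simpa [hk] using this

/-- The alternating function of `k` variables, a multiple of the Vandermonde determinant, attached
to a function on `k`-subsets. -/
noncomputable def altExtend :
    ({K : Finset (ZMod p) // K.card = k} → ZMod p) →ₗ[ZMod p] ((Fin k → ZMod p) → ZMod p) where
  toFun f x := (Matrix.vandermonde x).det *
    if h : (univ.image x).card = k then f ⟨univ.image x, h⟩ else 0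
  map_add' f g := by
    funext x
    by_cases h : (univ.image x).card = k <;> simp [h, mul_add]
  map_smul' c f := by
    funext x
    by_cases h : (univ.image x).card = k <;> simp [h, mul_left_comm]

variable {p k}

theorem altExtend_apply_of_image_eq (f : {K : Finset (ZMod p) // K.card = k} → ZMod p)
    (K : {K : Finset (ZMod p) // K.card = k}) {x : Fin k → ZMod p} (hx : univ.image x = K) :
    altExtend p k f x = (Matrix.vandermonde x).det * f K := by
  obtain ⟨K, hK⟩ := K
  obtain rfl : univ.image x = K := hx
  simp [altExtend, hK]

theorem altExtend_comp_perm (f : {K : Finset (ZMod p) // K.card = k} → ZMod p)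
    (x : Fin k → ZMod p) (τ : Perm (Fin k)) :
    altExtend p k f (x ∘ τ) = (Perm.sign τ : ℤ) * altExtend p k f x := by
  have h1 : univ.image (x ∘ τ) = univ.image x := by
    rw [← image_image, image_univ_equiv]
  have h2 : (Matrix.vandermonde (x ∘ τ)).det =
      ((Perm.sign τ : ℤ) : ZMod p) * (Matrix.vandermonde x).det := by
    rw [← Matrix.det_permute]
    rfl
  simp only [altExtend, LinearMap.coe_mk, AddHom.coe_mk, h1, h2, mul_assoc]

theorem sumShift_altExtend_comp_perm (f : {K : Finset (ZMod p) // K.card = k} → ZMod p)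
    (x : Fin k → ZMod p) (τ : Perm (Fin k)) :
    sumShift p k (altExtend p k f) (x ∘ τ) =
      (Perm.sign τ : ℤ) * sumShift p k (altExtend p k f) x := by
  rw [sumShift_apply, sumShift_apply, ← Equiv.sum_comp τ fun j => altExtend p k f (x + _),
    mul_sum]
  refine sum_congr rfl fun j _ => ?_
  rw [← altExtend_comp_perm]
  refine congrArg _ (funext fun i => ?_)
  simp [Pi.single_apply]

theorem sumShift_altExtend_eq_zero_of_not_injective (hp2 : p ≠ 2)
    (f : {K : Finset (ZMod p) // K.card = k} → ZMod p) {x : Fin k → ZMod p}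
    (hx : ¬ Function.Injective x) : sumShift p k (altExtend p k f) x = 0 := by
  simp only [Function.Injective, not_forall] at hx
  obtain ⟨i, j, hij, hne⟩ := hx
  have h := sumShift_altExtend_comp_perm f x (swap i j)
  have hxs : x ∘ swap i j = x := by
    funext l
    simp only [Function.comp_apply, swap_apply_def]
    split_ifs with h1 h2
    · rw [h1, hij]
    · rw [h2, hij]
    · rfl
  rw [hxs, Perm.sign_swap hne] at h
  have : Fact (2 < p) := ⟨lt_of_le_of_ne (Fact.out : p.Prime).two_le hp2.symm⟩
  refine (ZMod.neg_eq_self_iff _).1 ?_ |>.resolve_right ?_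
  · simpa using h.symm
  · intro h'
    have := (Fact.out : p.Prime).eq_one_or_self_of_dvd 2 ⟨_, h'.symm⟩
    omega

/-- The `k`-subsets of `ℤ/p` can be permuted so that each moves by replacing a single element `m`
with `m + 1`. -/
theorem exists_perm_subsets (hp2 : p ≠ 2) (hk : (k : ZMod p) ≠ 0) :
    ∃ π : Perm {K : Finset (ZMod p) // K.card = k}, ∀ K : {K : Finset (ZMod p) // K.card = k},
      ∃ m ∈ (K : Finset (ZMod p)),
      m + 1 ∉ (K : Finset (ZMod p)) ∧
        (π K : Finset (ZMod p)) = (K : Finset (ZMod p)).image (swap m (m + 1)) := by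
  classical
  have henum : ∀ K : {K : Finset (ZMod p) // K.card = k}, ∃ x : Fin k → ZMod p,
      Function.Injective x ∧ univ.image x = K := by
    rintro ⟨K, hK⟩
    refine ⟨fun i => (K.equivFinOfCardEq hK).symm i,
      Subtype.val_injective.comp (Equiv.injective _), ?_⟩
    ext m
    simp only [mem_image, mem_univ, true_and]
    constructor
    · rintro ⟨i, rfl⟩
      exact Subtype.prop _
    · intro hm
      exact ⟨K.equivFinOfCardEq hK ⟨m, hm⟩, by simp⟩
  choose enum enum_inj enum_image using henum
  let L : ({K : Finset (ZMod p) // K.card = k} → ZMod p) →ₗ[ZMod p]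
      ({K : Finset (ZMod p) // K.card = k} → ZMod p) :=
    LinearMap.funLeft (ZMod p) (ZMod p) enum ∘ₗ sumShift p k ∘ₗ altExtend p k
  have hL : LinearMap.ker L = ⊥ := by
    rw [LinearMap.ker_eq_bot']
    intro f hf
    have hzero : sumShift p k (altExtend p k f) = 0 := by
      funext x
      by_cases hx : Function.Injective x
      · let K : {K : Finset (ZMod p) // K.card = k} :=
          ⟨univ.image x, by rw [card_image_of_injective _ hx, card_fin]⟩
        have hτ : ∀ i, ∃ j, enum K j = x i := by
          intro i
          have : x i ∈ univ.image (enum K) := by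
            rw [enum_image]
            exact mem_image_of_mem _ (mem_univ i)
          simpa using this
        choose τ hτ using hτ
        have hτ_inj : Function.Injective τ := by
          intro i j hij
          apply hx
          rw [← hτ, ← hτ, hij]
        let τ' : Perm (Fin k) := Equiv.ofBijective τ (Finite.injective_iff_bijective.1 hτ_inj)
        have hx' : x = enum K ∘ τ' := by
          funext i
          exact (hτ i).symm
        have h0 : sumShift p k (altExtend p k f) (enum K) = 0 := congrFun hf K
        rw [hx', sumShift_altExtend_comp_perm, h0, mul_zero]
        rfl
      · exact sumShift_altExtend_eq_zero_of_not_injective hp2 f hx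
    have hext : altExtend p k f = 0 := sumShift_injective p k hk (by rw [hzero, map_zero])
    funext K
    have h := congrFun hext (enum K)
    rw [altExtend_apply_of_image_eq f K (enum_image K)] at h
    exact (mul_eq_zero.1 h).resolve_left (Matrix.det_vandermonde_ne_zero_iff.2 (enum_inj K))
  have hdet : (LinearMap.toMatrix' L).det ≠ 0 := by
    rw [LinearMap.det_toMatrix']
    exact (LinearMap.isUnit_iff_isUnit_det L).1 ((LinearMap.isUnit_iff_ker_eq_bot L).2 hL) |>.ne_zero
  rw [← Matrix.det_transpose, Matrix.det_apply] at hdet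
  obtain ⟨π, -, hπ⟩ := exists_ne_zero_of_sum_ne_zero hdet
  refine ⟨π, fun K => ?_⟩
  have hentry : L (Pi.single (π K) 1) K ≠ 0 := by
    intro h
    refine hπ ?_
    rw [prod_eq_zero (mem_univ K), smul_zero]
    rw [Matrix.transpose_apply, LinearMap.toMatrix'_apply, h]
  replace hentry : sumShift p k (altExtend p k (Pi.single (π K) 1)) (enum K) ≠ 0 := hentry
  rw [sumShift_apply] at hentry
  obtain ⟨j, -, hj⟩ := exists_ne_zero_of_sum_ne_zero hentry
  have hinj : Function.Injective (enum K + Pi.single j 1) := by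
    rw [← Matrix.det_vandermonde_ne_zero_iff]
    exact left_ne_zero_of_mul hj
  let K' : {K : Finset (ZMod p) // K.card = k} :=
    ⟨univ.image (enum K + Pi.single j 1), by rw [card_image_of_injective _ hinj, card_fin]⟩
  rw [altExtend_apply_of_image_eq _ K' rfl] at hj
  have hK' : π K = K' := by
    by_contra hne
    exact right_ne_zero_of_mul hj (Pi.single_eq_of_ne (Ne.symm hne) 1)
  have hmove : ∀ i, i ≠ j → enum K i ≠ enum K j + 1 := by
    intro i hi h
    exact hi (hinj (by simp [hi, h]))
  refine ⟨enum K j, ?_, ?_, ?_⟩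
  · rw [← enum_image K]
    exact mem_image_of_mem _ (mem_univ j)
  · rw [← enum_image K]
    simp only [mem_image, mem_univ, true_and, not_exists]
    intro i
    by_cases hi : i = j
    · subst hi
      simp
    · exact hmove i hi
  · rw [hK', ← enum_image K, image_image]
    refine image_congr fun i _ => ?_
    by_cases hi : i = j
    · subst hi
      simp
    · simp [hi, swap_apply_of_ne_of_ne (fun h => hi (enum_inj K h)) (hmove i hi)]

/-- The permutations of `ℤ/p` can be permuted so that each is changed by exchanging some value `m`,
taken in `S`, with the value `m + 1`, taken outside `S`. -/
theorem exists_perm_perms (hp2 : p ≠ 2) (S : Finset (ZMod p)) (hS : S.Nonempty) (hS' : S ≠ univ) :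
    ∃ (Φ : Perm (Perm (ZMod p))) (i j : Perm (ZMod p) → ZMod p), ∀ σ,
      i σ ∈ S ∧ j σ ∉ S ∧ σ (j σ) = σ (i σ) + 1 ∧ Φ σ = σ * swap (i σ) (j σ) := by
  have hlt : S.card < p := by
    simpa [ZMod.card] using (card_lt_iff_ne_univ S).2 hS'
  have hk : (S.card : ZMod p) ≠ 0 := by
    rw [Ne, CharP.cast_eq_zero_iff (ZMod p) p]
    exact Nat.not_dvd_of_pos_of_lt hS.card_pos hlt
  obtain ⟨π, hπ⟩ := exists_perm_subsets hp2 hk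
  choose m hm hm' hπ using hπ
  let K : Perm (ZMod p) → {K : Finset (ZMod p) // K.card = S.card} := fun σ =>
    ⟨S.image σ, card_image_of_injective _ σ.injective⟩
  let φ : Perm (ZMod p) → Perm (ZMod p) := fun σ => swap (m (K σ)) (m (K σ) + 1) * σ
  have hK : ∀ σ, K (φ σ) = π (K σ) := by
    intro σ
    apply Subtype.ext
    rw [hπ]
    simp only [K, φ, image_image]
    rfl
  have hφ : Function.Injective φ := by
    intro σ τ h
    have hKK : K σ = K τ := π.injective (by rw [← hK, ← hK, h])
    simpa only [φ, hKK, mul_right_inj] using h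
  refine ⟨Equiv.ofBijective φ (Finite.injective_iff_bijective.1 hφ),
    fun σ => σ⁻¹ (m (K σ)), fun σ => σ⁻¹ (m (K σ) + 1), fun σ => ⟨?_, ?_, by simp, ?_⟩⟩
  · obtain ⟨i, hi, h⟩ := mem_image.1 (hm (K σ))
    simpa [← h] using hi
  · intro h
    refine hm' (K σ) (mem_image.2 ⟨_, h, ?_⟩)
    simp
  · rw [mul_swap_eq_swap_mul]
    simp [φ]

theorem val_add_one_eq (m : ZMod p) :
    ((m + 1).val : ℤ) = m.val + 1 - p * if m = -1 then 1 else 0 := by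
  have hp := (Fact.out : p.Prime).two_le
  have : Fact (1 < p) := ⟨hp⟩
  split_ifs with h
  · subst h
    obtain ⟨q, rfl⟩ : ∃ q, p = q + 1 := ⟨p - 1, by omega⟩
    rw [neg_add_cancel, ZMod.val_neg_one, ZMod.val_zero]
    push_cast
    ring
  · have hlt := m.val_lt
    have hne : m.val + 1 ≠ p := by
      intro h'
      apply h
      have := congrArg (fun q : ℕ => (q : ZMod p)) h'
      simp only [Nat.cast_add, ZMod.natCast_zmod_val, CharP.cast_eq_zero, Nat.cast_one] at this
      exact eq_neg_of_add_eq_zero_left this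
    rw [ZMod.val_add_of_lt (by rw [ZMod.val_one]; omega), ZMod.val_one]
    simp

theorem card_perm_level_le (hp2 : p ≠ 2) (a u : ZMod p → ℝ)
    (hu : ∀ i j, i.val < j.val → u i < u j) (ha : ∃ i j, a i ≠ a j) (c : ℝ) :
    (univ.filter fun σ : Perm (ZMod p) => ∑ i, a i * u (σ i) = c).card ≤ (p - 1).factorial := by
  have hp := (Fact.out : p.Prime).two_le
  obtain ⟨i₀, -, hi₀⟩ := exists_max_image univ a univ_nonempty
  let S := univ.filter fun i => a i = a i₀
  have hS' : S ≠ univ := by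
    intro h
    obtain ⟨i, j, hij⟩ := ha
    have hall : ∀ i, a i = a i₀ := by simpa [S, filter_eq_self] using h
    exact hij ((hall i).trans (hall j).symm)
  obtain ⟨Φ, i, j, h⟩ := exists_perm_perms hp2 S ⟨i₀, by simp [S]⟩ hS'
  let W := univ.filter fun σ : Perm (ZMod p) => σ (i σ) = -1
  have hne : ∀ σ, i σ ≠ j σ := fun σ hij => (h σ).2.1 (hij ▸ (h σ).1)
  have hW : W.card = (p - 1).factorial := by
    have hstep : ∀ σ, ∑ l ∈ S, ((Φ σ l).val : ℤ) =
        ∑ l ∈ S, ((σ l).val : ℤ) + 1 - p * if σ (i σ) = -1 then 1 else 0 := by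
      intro σ
      obtain ⟨hi, hj, hσ, hΦ⟩ := h σ
      have hrest : ∑ l ∈ S.erase (i σ), ((Φ σ l).val : ℤ) =
          ∑ l ∈ S.erase (i σ), ((σ l).val : ℤ) := by
        refine sum_congr rfl fun l hl => ?_
        rw [mem_erase] at hl
        rw [hΦ, Perm.mul_apply, swap_apply_of_ne_of_ne hl.1 (by rintro rfl; exact hj hl.2)]
      rw [← add_sum_erase _ _ hi, ← add_sum_erase _ _ hi, hrest, hΦ, Perm.mul_apply,
        swap_apply_left, hσ, val_add_one_eq]
      ring
    have hsum := Equiv.sum_comp Φ fun σ => ∑ l ∈ S, ((σ l).val : ℤ)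
    simp only [hstep, sum_sub_distrib, sum_add_distrib, ← mul_sum, sum_boole] at hsum
    have hcard : (Fintype.card (Perm (ZMod p)) : ℤ) = p * W.card := by
      simp only [sum_const, card_univ, nsmul_eq_mul, mul_one] at hsum
      simp only [W]
      linarith
    rw [Fintype.card_perm, ZMod.card, ← Nat.mul_factorial_pred (by omega : p ≠ 0)] at hcard
    have hcard' : p * (p - 1).factorial = p * W.card := by exact_mod_cast hcard
    exact (Nat.eq_of_mul_eq_mul_left (by omega) hcard').symm
  rw [← hW]
  refine card_level_le_of_perm Φ _ W (fun σ hσ => ?_) c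
  obtain ⟨hi, hj, hσij, hΦ⟩ := h σ
  have hlt : u (σ (i σ)) < u (σ (j σ)) := by
    apply hu
    have := val_add_one_eq (σ (i σ))
    rw [if_neg (by simpa [W] using hσ)] at this
    rw [hσij]
    omega
  have haj : a (j σ) < a (i σ) := by
    have h1 : a (i σ) = a i₀ := by simpa [S] using hi
    have h2 : a (j σ) ≠ a i₀ := by simpa [S] using hj
    rw [h1]
    exact lt_of_le_of_ne (hi₀ _ (mem_univ _)) h2
  rw [← sub_pos, ← sum_sub_distrib, sum_eq_add (i σ) (j σ) (hne σ)]
  · simp only [hΦ, Perm.mul_apply, swap_apply_left, swap_apply_right]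
    nlinarith [mul_pos (sub_pos.2 hlt) (sub_pos.2 haj)]
  · intro l _ hl
    rw [hΦ, Perm.mul_apply, swap_apply_of_ne_of_ne hl.1 hl.2, sub_self]
  · simp
  · simp

end ExclusionProcess

open Finset Equiv in
/-- The orbit of a vector with distinct coordinates meets a hyperplane whose normal vector is not
constant in at most `(n - 1)!` points. -/
theorem ncard_orbit_inter_hyperplane_le {n : ℕ} (hn : 3 ≤ n) (hp : n.Prime) {v : Fin n → ℝ}
    (hv : Function.Injective v) {a : Fin n → ℝ} (ha : ∃ i j, a i ≠ a j) :
    ({x : Fin n → ℝ | ∑ i, a i * x i = 0} ∩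
      {w : Fin n → ℝ | ∃ σ : Perm (Fin n), w = fun i => v (σ⁻¹ i)}).ncard
      ≤ (n - 1).factorial := by
  have : Fact n.Prime := ⟨hp⟩
  obtain ⟨e, he⟩ : ∃ e : ZMod n ≃ Fin n, ∀ i, (e i : ℕ) = i.val := by
    obtain ⟨q, rfl⟩ : ∃ q, n = q + 1 := ⟨n - 1, by omega⟩
    exact ⟨Equiv.refl _, fun i => rfl⟩
  let τ : Perm (Fin n) := Tuple.sort v
  have hτ : StrictMono (v ∘ τ) :=
    (Tuple.monotone_sort v).strictMono_of_injective (hv.comp τ.injective)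
  have hle := card_perm_level_le (by omega : n ≠ 2) (a ∘ e) (v ∘ τ ∘ e)
    (fun i j hij => hτ (by rw [Fin.lt_def, he, he]; exact hij))
    (by
      obtain ⟨i, j, hij⟩ := ha
      exact ⟨e.symm i, e.symm j, by simpa using hij⟩) 0
  refine le_trans ?_ hle
  rw [← Set.ncard_coe_finset]
  refine le_trans (Set.ncard_le_ncard ?_ ?_) (Set.ncard_image_le (s := _)
    (f := fun (σ : Perm (ZMod n)) (i : Fin n) => v (τ (e (σ (e.symm i))))) (Set.toFinite _))
  · rintro w ⟨hw, σ, rfl⟩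
    refine ⟨(e.trans (σ⁻¹.trans τ.symm)).trans e.symm, ?_, ?_⟩
    · simp only [coe_filter, mem_univ, true_and, Set.mem_ofPred_eq]
      rw [← hw, ← Equiv.sum_comp e]
      simp
    · funext i
      simp
  · exact Set.toFinite _

open Finset Equiv in
theorem ncard_orbit_apply_eq {n : ℕ} {v : Fin n → ℝ} (hv : Function.Injective v) (i₀ : Fin n) :
    {w : Fin n → ℝ | (∃ σ : Perm (Fin n), w = fun i => v (σ⁻¹ i)) ∧ w i₀ = v i₀}.ncard =
      (n - 1).factorial := by
  have himage : {w : Fin n → ℝ | (∃ σ : Perm (Fin n), w = fun i => v (σ⁻¹ i)) ∧ w i₀ = v i₀} =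
      (fun (σ : Perm (Fin n)) i => v (σ i)) '' (MulAction.stabilizer (Perm (Fin n)) i₀) := by
    ext w
    constructor
    · rintro ⟨⟨σ, rfl⟩, h⟩
      exact ⟨σ⁻¹, hv h, rfl⟩
    · rintro ⟨σ, hσ, rfl⟩
      exact ⟨⟨σ⁻¹, by simp⟩, congrArg v hσ⟩
  rw [himage, Set.ncard_image_of_injective]
  · have hindex := (MulAction.stabilizer (Perm (Fin n)) i₀).card_mul_index
    rw [MulAction.index_stabilizer_of_transitive, Nat.card_perm, Nat.card_fin,
      ← Nat.mul_factorial_pred (Nat.ne_of_gt i₀.pos), mul_comm] at hindex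
    exact Nat.eq_of_mul_eq_mul_left i₀.pos hindex
  · intro σ τ h
    exact Equiv.ext fun i => hv (congrFun h i)

/-- Let `n ≥ 3` be prime. Then (a) for every `v ∈ ℝ^n` with pairwise distinct
coordinates, not summing to `0`, and every hyperplane `H` through the origin,
`|H ∩ Sₙ·v| ≤ (n-1)!`; and (b) for every such `v` there is a hyperplane through the origin
achieving `|H ∩ Sₙ·v| = (n-1)!`. -/
theorem stmt1 (n : ℕ) (hn : 3 ≤ n) (hp : n.Prime) :
    ∀ v : Fin n → ℝ, (∀ i j : Fin n, i ≠ j → v i ≠ v j) → (∑ i, v i ≠ 0) →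
      ((∀ a : Fin n → ℝ, a ≠ 0 →
          ({x : Fin n → ℝ | ∑ i, a i * x i = 0} ∩
            {w : Fin n → ℝ | ∃ σ : Equiv.Perm (Fin n), w = fun i => v (σ⁻¹ i)}).ncard
            ≤ (n - 1).factorial) ∧
        (∃ a : Fin n → ℝ, a ≠ 0 ∧
          ({x : Fin n → ℝ | ∑ i, a i * x i = 0} ∩
            {w : Fin n → ℝ | ∃ σ : Equiv.Perm (Fin n), w = fun i => v (σ⁻¹ i)}).ncard
            = (n - 1).factorial)) := by
  intro v hv hsum
  have hinj : Function.Injective v := fun i j h => by_contra fun hij => hv i j hij h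
  have horbit : ∀ σ : Equiv.Perm (Fin n), ∑ i, v (σ⁻¹ i) = ∑ i, v i := fun σ =>
    Equiv.sum_comp σ⁻¹ v
  constructor
  · intro a ha
    by_cases hconst : ∃ i j, a i ≠ a j
    · exact ncard_orbit_inter_hyperplane_le hn hp hinj hconst
    · push Not at hconst
      refine le_of_eq_of_le ?_ (Nat.zero_le _)
      convert Set.ncard_empty (Fin n → ℝ)
      rw [Set.eq_empty_iff_forall_notMem]
      rintro w ⟨hw, σ, rfl⟩
      apply ha
      funext j
      have hw' : ∑ i, a i * v (σ⁻¹ i) = 0 := hw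
      simp only [hconst _ j, ← Finset.mul_sum, horbit] at hw'
      exact (mul_eq_zero.1 hw').resolve_right hsum
  · let i₀ : Fin n := ⟨0, by omega⟩
    let i₁ : Fin n := ⟨1, by omega⟩
    have hne : i₁ ≠ i₀ := by simp [i₀, i₁]
    have hne_zero : (fun i => (if i = i₀ then ∑ l, v l else 0) - v i₀) ≠ 0 := by
      intro h
      have h0 := congrFun h i₀
      have h1 := congrFun h i₁
      simp only [if_true, if_neg hne, Pi.zero_apply] at h0 h1
      exact hsum (by linarith)
    refine ⟨_, hne_zero, ?_⟩
    rw [← ncard_orbit_apply_eq hinj i₀]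
    congr 1
    ext w
    simp only [Set.mem_inter_iff, Set.mem_ofPred_eq]
    rw [and_comm]
    refine and_congr_right ?_
    rintro ⟨σ, rfl⟩
    simp only [sub_mul, ite_mul, zero_mul, Finset.sum_sub_distrib, Finset.sum_ite_eq',
      Finset.mem_univ, if_true, ← Finset.mul_sum, horbit]
    rw [mul_comm (v i₀), ← mul_sub, mul_eq_zero, sub_eq_zero, or_iff_right hsum]
end

section
/- Let n ≥ 2. There exists a nonzero polynomial F ∈ ℝ[x_1,…,x_n] such that every v ∈ ℝ^n with F(v) ≠ 0 has pairwise distinct coordinates and satisfies: (a) for every hyperplane H ⊆ ℝ^n through the origin, |H ∩ S_n·v| ≤ (n−1)!; and (b) there exists a hyperplane H through the origin with |H ∩ S_n·v| = (n−1)!. -/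
section OrbitHyperplane

open Finset Equiv Filter Topology

open Classical in
/-- The permutations `σ` for which `v` rearranged by `σ` lies on the hyperplane with normal `a`. -/
noncomputable def hyperplanePerms {n : ℕ} (v a : Fin n → ℝ) : Finset (Perm (Fin n)) :=
  {σ | ∑ j, a (σ j) * v j = 0}

/-- Every hyperplane through the origin contains at most `(n - 1)!` rearrangements of `v`. -/
def HasSmallHyperplaneSections {n : ℕ} (v : Fin n → ℝ) : Prop :=
  ∀ a : Fin n → ℝ, a ≠ 0 → #(hyperplanePerms v a) ≤ (n - 1).factorial

theorem mem_hyperplanePerms {n : ℕ} {v a : Fin n → ℝ} {σ : Perm (Fin n)} :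
    σ ∈ hyperplanePerms v a ↔ ∑ j, a (σ j) * v j = 0 := by
  simp [hyperplanePerms]

theorem mem_hyperplanePerms_iff_sum_inv {n : ℕ} {v a : Fin n → ℝ} {σ : Perm (Fin n)} :
    σ ∈ hyperplanePerms v a ↔ ∑ i, a i * v (σ⁻¹ i) = 0 := by
  rw [mem_hyperplanePerms, ← Equiv.sum_comp σ (fun i => a i * v (σ⁻¹ i))]
  simp

theorem hyperplanePerms_smul {n : ℕ} (v a : Fin n → ℝ) {c : ℝ} (hc : c ≠ 0) :
    hyperplanePerms v (c • a) = hyperplanePerms v a := by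
  ext σ
  simp [mem_hyperplanePerms, mul_assoc, ← Finset.mul_sum, hc]

theorem card_perm_apply_zero_eq {m : ℕ} (p : Fin (m + 1)) :
    #{σ : Perm (Fin (m + 1)) | σ 0 = p} = m.factorial := by
  have : ({σ : Perm (Fin (m + 1)) | σ 0 = p} : Finset _) =
      (univ : Finset (Perm (Fin m))).image fun e => Perm.decomposeFin.symm (p, e) := by
    ext σ
    simp only [mem_filter, mem_univ, true_and, mem_image]
    constructor
    · intro h
      obtain ⟨⟨q, e⟩, rfl⟩ := Perm.decomposeFin.symm.surjective σ
      rw [Perm.decomposeFin_symm_apply_zero] at h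
      exact ⟨e, by rw [h]⟩
    · rintro ⟨e, rfl⟩
      exact Perm.decomposeFin_symm_apply_zero p e
  rw [this, card_image_of_injective _ fun e e' h => by simpa using h, card_univ,
    Fintype.card_perm, Fintype.card_fin]

/-- Affine hyperplanes whose normal is not constant contain no more rearrangements of `u` than
linear ones. -/
theorem HasSmallHyperplaneSections.card_le_of_sum_eq {m : ℕ} {u : Fin m → ℝ}
    (hu : HasSmallHyperplaneSections u) (hs : ∑ j, u j ≠ 0) {a : Fin m → ℝ}
    (ha : ∃ i j, a i ≠ a j) {S : Finset (Perm (Fin m))}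
    (hS : ∀ e ∈ S, ∀ e' ∈ S, ∑ j, a (e j) * u j = ∑ j, a (e' j) * u j) :
    #S ≤ (m - 1).factorial := by
  rcases S.eq_empty_or_nonempty with rfl | ⟨e₀, he₀⟩
  · simp
  set c := (∑ j, a (e₀ j) * u j) / ∑ j, u j with hc
  refine (card_le_card fun e he => ?_).trans (hu (fun i => a i - c) fun h => ?_)
  · rw [mem_hyperplanePerms]
    simp only [sub_mul, sum_sub_distrib, ← Finset.mul_sum]
    rw [hS e he e₀ he₀, hc, div_mul_cancel₀ _ hs, sub_self]
  · obtain ⟨i, j, hij⟩ := ha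
    have hi := congrFun h i
    have hj := congrFun h j
    simp only [Pi.zero_apply] at hi hj
    exact hij (by linarith)

theorem HasSmallHyperplaneSections.card_le_of_apply_zero_eq {m : ℕ} {u : Fin m → ℝ}
    (hu : HasSmallHyperplaneSections u) (hs : ∑ j, u j ≠ 0) {a : Fin (m + 1) → ℝ}
    {p : Fin (m + 1)} (ha : ∃ i j, i ≠ p ∧ j ≠ p ∧ a i ≠ a j) {S : Finset (Perm (Fin (m + 1)))}
    (hp : ∀ σ ∈ S, σ 0 = p)
    (hS : ∀ σ ∈ S, ∀ σ' ∈ S, ∑ j : Fin m, a (σ j.succ) * u j = ∑ j : Fin m, a (σ' j.succ) * u j) :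
    #S ≤ (m - 1).factorial := by
  have himage : S = (S.image fun σ => (Perm.decomposeFin σ).2).image
      fun e => Perm.decomposeFin.symm (p, e) := by
    have h : ∀ σ ∈ S, Perm.decomposeFin.symm (p, (Perm.decomposeFin σ).2) = σ := by
      intro σ hσ
      obtain ⟨⟨q, e⟩, rfl⟩ := Perm.decomposeFin.symm.surjective σ
      have := hp _ hσ
      rw [Perm.decomposeFin_symm_apply_zero] at this
      simp [this]
    rw [image_image]
    exact (image_id.symm.trans (image_congr fun σ hσ => (h σ hσ).symm))
  set T := S.image fun σ => (Perm.decomposeFin σ).2 with hT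
  have hmem : ∀ e ∈ T, Perm.decomposeFin.symm (p, e) ∈ S := fun e he => by
    rw [himage]; exact mem_image_of_mem _ he
  rw [himage]
  refine card_image_le.trans
    (hu.card_le_of_sum_eq hs (a := fun k => a (swap 0 p k.succ)) ?_ fun e he e' he' => ?_)
  · obtain ⟨i, j, hi, hj, hij⟩ := ha
    have key : ∀ i, i ≠ p → ∃ k : Fin m, swap 0 p k.succ = i := by
      intro i hi
      have h0 : swap 0 p i ≠ 0 := by
        intro h
        apply hi
        have := congrArg (swap 0 p) h
        simpa using this
      obtain ⟨k, hk⟩ := Fin.exists_succ_eq.2 h0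
      exact ⟨k, by rw [hk]; simp⟩
    obtain ⟨k, rfl⟩ := key i hi
    obtain ⟨l, rfl⟩ := key j hj
    exact ⟨k, l, hij⟩
  · simpa only [Perm.decomposeFin_symm_apply_succ] using hS _ (hmem e he) _ (hmem e' he')

theorem HasSmallHyperplaneSections.card_le_of_degenerate {m : ℕ} (hm : 1 ≤ m) {u : Fin m → ℝ}
    (hu : HasSmallHyperplaneSections u) (hs : ∑ j, u j ≠ 0) {a : Fin (m + 1) → ℝ} (ha : a ≠ 0)
    {S : Finset (Perm (Fin (m + 1)))} (h0 : ∀ σ ∈ S, a (σ 0) = 0)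
    (hS : ∀ σ ∈ S, ∀ σ' ∈ S, σ 0 = σ' 0 →
      ∑ j : Fin m, a (σ j.succ) * u j = ∑ j : Fin m, a (σ' j.succ) * u j) :
    #S ≤ m.factorial := by
  classical
  set Z : Finset (Fin (m + 1)) := {p | a p = 0} with hZ
  obtain ⟨q, hq⟩ := Function.ne_iff.1 ha
  have hmaps : ∀ σ ∈ S, σ 0 ∈ Z := fun σ hσ => by simpa [hZ] using h0 σ hσ
  by_cases hZ1 : #Z ≤ 1
  · refine (card_le_mul_card_image_of_maps_to hmaps m.factorial fun p _ => ?_).trans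
      (by simpa using Nat.mul_le_mul_left m.factorial hZ1)
    rw [← card_perm_apply_zero_eq p]
    exact card_le_card (filter_subset_filter _ (subset_univ _))
  · have hZm : #Z ≤ m := by
      have : Z ⊆ univ.erase q := fun p hp => by
        simp only [mem_erase, mem_univ, and_true]
        rintro rfl
        exact hq (by simpa [hZ] using hp)
      simpa using card_le_card this
    refine (card_le_mul_card_image_of_maps_to hmaps (m - 1).factorial fun p hp => ?_).trans ?_
    · obtain ⟨r, hr, hrp⟩ := exists_mem_ne (not_le.1 hZ1) p
      have hr0 : a r = 0 := by simpa [hZ] using hr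
      have hp0 : a p = 0 := by simpa [hZ] using hp
      refine hu.card_le_of_apply_zero_eq hs (a := a) (p := p)
        ⟨q, r, ?_, hrp, by simpa [hr0] using hq⟩ ?_ ?_
      · rintro rfl
        exact hq hp0
      · intro σ hσ
        exact (mem_filter.1 hσ).2
      · intro σ hσ σ' hσ'
        rw [mem_filter] at hσ hσ'
        exact hS σ hσ.1 σ' hσ'.1 (hσ.2.trans hσ'.2.symm)
    · rw [← Nat.mul_factorial_pred (by lia : m ≠ 0), mul_comm]
      exact Nat.mul_le_mul_right _ hZm

theorem exists_cons_hasSmallHyperplaneSections {m : ℕ} (hm : 1 ≤ m) {u : Fin m → ℝ}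
    (hu : HasSmallHyperplaneSections u) (hs : ∑ j, u j ≠ 0) :
    ∃ t : ℝ, ∑ j, (Fin.cons 1 (t • u) : Fin (m + 1) → ℝ) j ≠ 0 ∧
      HasSmallHyperplaneSections (Fin.cons 1 (t • u) : Fin (m + 1) → ℝ) := by
  by_contra! H
  have hsum : ∀ᶠ t : ℝ in 𝓝[≠] 0, ∑ j, (Fin.cons 1 (t • u) : Fin (m + 1) → ℝ) j ≠ 0 := by
    have hcont : Continuous fun t : ℝ => 1 + t * ∑ j, u j := by fun_prop
    have : ∀ᶠ t : ℝ in 𝓝 0, 1 + t * ∑ j, u j ≠ 0 :=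
      hcont.continuousAt.eventually_ne (by simp)
    filter_upwards [this.filter_mono nhdsWithin_le_nhds] with t ht
    simpa [Fin.sum_univ_succ, ← Finset.mul_sum] using ht
  have hex : ∀ t : ℝ, ∃ a : Fin (m + 1) → ℝ,
      ∑ j, (Fin.cons 1 (t • u) : Fin (m + 1) → ℝ) j ≠ 0 → ‖a‖ = 1 ∧
        m.factorial < #(hyperplanePerms (Fin.cons 1 (t • u)) a) := by
    intro t
    by_cases ht : ∑ j, (Fin.cons 1 (t • u) : Fin (m + 1) → ℝ) j = 0
    · exact ⟨0, fun h => absurd ht h⟩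
    · have := H t ht
      rw [HasSmallHyperplaneSections] at this
      push Not at this
      obtain ⟨a, ha, hlt⟩ := this
      refine ⟨‖a‖⁻¹ • a, fun _ => ⟨norm_smul_inv_norm ha, ?_⟩⟩
      rw [hyperplanePerms_smul _ _ (inv_ne_zero (norm_ne_zero_iff.2 ha))]
      simpa using hlt
  choose a ha using hex
  set 𝒰 : Ultrafilter ℝ := Ultrafilter.of (𝓝[≠] 0)
  have hle : (𝒰 : Filter ℝ) ≤ 𝓝[≠] 0 := Ultrafilter.of_le _
  have hnorm : ∀ᶠ t in (𝒰 : Filter ℝ), a t ∈ Metric.sphere (0 : Fin (m + 1) → ℝ) 1 := by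
    filter_upwards [hsum.filter_mono hle] with t ht
    simpa using (ha t ht).1
  obtain ⟨b, hb, hab⟩ := (isCompact_sphere (0 : Fin (m + 1) → ℝ) 1).ultrafilter_le_nhds'
    (𝒰.map a) hnorm
  have hlim : ∀ i, Tendsto (fun t => a t i) 𝒰 (𝓝 (b i)) := tendsto_pi_nhds.1 hab
  have hlim0 : Tendsto (fun t : ℝ => t) 𝒰 (𝓝 0) := hle.trans nhdsWithin_le_nhds
  obtain ⟨S, hS⟩ := (𝒰.map fun t => hyperplanePerms (Fin.cons 1 (t • u)) (a t)).eq_pure_of_finite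
  have hSev : ∀ᶠ t in (𝒰 : Filter ℝ), hyperplanePerms (Fin.cons 1 (t • u)) (a t) = S := by
    have : ({S} : Set (Finset (Perm (Fin (m + 1))))) ∈
        𝒰.map fun t => hyperplanePerms (Fin.cons 1 (t • u)) (a t) := by
      rw [hS]; exact Set.mem_singleton S
    exact this
  have hcard : m.factorial < #S := by
    obtain ⟨t, ht, htS⟩ := ((hsum.filter_mono hle).and hSev).exists
    rw [← htS]
    exact (ha t ht).2
  have heq : ∀ σ ∈ S, ∀ᶠ t in (𝒰 : Filter ℝ),
      a t (σ 0) + t * ∑ j : Fin m, a t (σ j.succ) * u j = 0 := by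
    intro σ hσ
    filter_upwards [hSev] with t ht
    rw [← ht, mem_hyperplanePerms, Fin.sum_univ_succ] at hσ
    simpa [Finset.mul_sum, mul_left_comm] using hσ
  have hlimsum : ∀ σ : Perm (Fin (m + 1)), Tendsto (fun t => ∑ j : Fin m, a t (σ j.succ) * u j) 𝒰
      (𝓝 (∑ j : Fin m, b (σ j.succ) * u j)) := fun σ =>
    tendsto_finsetSum _ fun j _ => (hlim _).mul_const _
  refine hcard.not_ge (hu.card_le_of_degenerate hm hs (a := b) ?_ ?_ ?_)
  · rintro rfl
    simp at hb
  · intro σ hσ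
    have h1 := (hlim (σ 0)).add (hlim0.mul (hlimsum σ))
    rw [zero_mul, add_zero] at h1
    exact tendsto_nhds_unique h1 (tendsto_const_nhds.congr' ((heq σ hσ).mono fun t ht => ht.symm))
  · intro σ hσ σ' hσ' h
    refine tendsto_nhds_unique (hlimsum σ) ((hlimsum σ').congr' ?_)
    have hne : ∀ᶠ t in (𝒰 : Filter ℝ), t ≠ 0 := hle self_mem_nhdsWithin
    filter_upwards [heq σ hσ, heq σ' hσ', hne] with t h1 h2 ht
    rw [h] at h1
    exact mul_left_cancel₀ ht (by linarith)

theorem exists_hasSmallHyperplaneSections (m : ℕ) :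
    ∃ v : Fin (m + 1) → ℝ, ∑ j, v j ≠ 0 ∧ HasSmallHyperplaneSections v := by
  induction m with
  | zero => exact ⟨1, by simp, fun a _ => (card_le_univ _).trans (by simp)⟩
  | succ m ih =>
    obtain ⟨u, hs, hu⟩ := ih
    obtain ⟨t, ht⟩ := exists_cons_hasSmallHyperplaneSections (by lia) hu hs
    exact ⟨_, ht⟩

theorem exists_det_ne_zero_of_forall_dotProduct_eq_zero {ι : Type*} {n : ℕ} (w : ι → Fin n → ℝ)
    (h : ∀ a : Fin n → ℝ, (∀ i, ∑ k, a k * w i k = 0) → a = 0) :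
    ∃ f : Fin n → ι, (Matrix.of fun k => w (f k)).det ≠ 0 := by
  have hspan : Submodule.span ℝ (Set.range w) = ⊤ := by
    by_contra hne
    obtain ⟨φ, hφ, hle⟩ := Submodule.exists_le_ker_of_lt_top _ (lt_top_iff_ne_top.2 hne)
    have hφx : ∀ x, φ x = ∑ k, φ (Pi.single k 1) * x k := fun x => by
      conv_lhs => rw [pi_eq_sum_univ' x]
      simp [mul_comm]
    have := h (fun k => φ (Pi.single k 1)) fun i => by
      rw [← hφx]
      exact hle (Submodule.subset_span ⟨i, rfl⟩)
    exact hφ (LinearMap.ext fun x => by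
      rw [hφx]
      simp [fun k => congrFun this k])
  obtain ⟨g, hg, -, hli⟩ := Submodule.exists_fun_fin_finrank_span_eq ℝ (Set.range w)
  have hn : Module.finrank ℝ (Submodule.span ℝ (Set.range w)) = n := by
    rw [hspan, finrank_top, Module.finrank_fin_fun]
  choose f hf using hg
  refine ⟨f ∘ Fin.cast hn.symm, ?_⟩
  rw [← isUnit_iff_ne_zero, ← Matrix.isUnit_iff_isUnit_det,
    ← Matrix.linearIndependent_rows_iff_isUnit]
  have : (Matrix.of fun k => w ((f ∘ Fin.cast hn.symm) k)).row = g ∘ Fin.cast hn.symm := by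
    funext k
    exact hf _
  rw [this]
  exact hli.comp _ (Fin.cast_injective _)

/-- The property of having small hyperplane sections is Zariski open. -/
theorem HasSmallHyperplaneSections.exists_mvPolynomial {n : ℕ} {v₀ : Fin n → ℝ}
    (h : HasSmallHyperplaneSections v₀) :
    ∃ F : MvPolynomial (Fin n) ℝ, F ≠ 0 ∧
      ∀ v, MvPolynomial.eval v F ≠ 0 → HasSmallHyperplaneSections v := by
  classical
  let M (R : Type) (x : Fin n → R) (f : Fin n → Perm (Fin n)) : Matrix (Fin n) (Fin n) R :=
    Matrix.of fun k i => x ((f k)⁻¹ i)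
  have heval : ∀ (v : Fin n → ℝ) f,
      MvPolynomial.eval v (M _ MvPolynomial.X f).det = (M _ v f).det := fun v f => by
    rw [RingHom.map_det]
    congr 1
    ext k i
    simp [M]
  refine ⟨∏ f with (M _ v₀ f).det ≠ 0, (M _ MvPolynomial.X f).det, ?_, fun v hv a ha => ?_⟩
  · refine prod_ne_zero_iff.2 fun f hf h0 => (mem_filter.1 hf).2 ?_
    rw [← heval, h0, map_zero]
  · rw [map_prod, prod_ne_zero_iff] at hv
    by_contra hlt
    obtain ⟨f, hf⟩ := exists_det_ne_zero_of_forall_dotProduct_eq_zero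
      (fun (σ : hyperplanePerms v a) i => v₀ (σ.1⁻¹ i)) fun b hb => by
        by_contra hb0
        refine hlt ((card_le_card fun σ hσ => ?_).trans (h b hb0))
        exact mem_hyperplanePerms_iff_sum_inv.2 (hb ⟨σ, hσ⟩)
    have hdet := hv (fun k => f k) (mem_filter.2 ⟨mem_univ _, hf⟩)
    rw [heval] at hdet
    refine hdet (Matrix.exists_mulVec_eq_zero_iff.1 ⟨a, ha, funext fun k => ?_⟩)
    have := mem_hyperplanePerms_iff_sum_inv.1 (f k).2
    simpa [Matrix.mulVec, dotProduct, M, mul_comm] using this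

theorem inter_orbit_eq_image {n : ℕ} (v a : Fin n → ℝ) :
    {x : Fin n → ℝ | ∑ i, a i * x i = 0} ∩
      {w : Fin n → ℝ | ∃ σ : Perm (Fin n), w = fun i => v (σ⁻¹ i)} =
    (fun σ : Perm (Fin n) => fun i => v (σ⁻¹ i)) '' (hyperplanePerms v a) := by
  ext w
  constructor
  · rintro ⟨hw, σ, rfl⟩
    exact ⟨σ, mem_hyperplanePerms_iff_sum_inv.2 hw, rfl⟩
  · rintro ⟨σ, hσ, rfl⟩
    exact ⟨mem_hyperplanePerms_iff_sum_inv.1 hσ, σ, rfl⟩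

theorem ncard_inter_orbit {n : ℕ} {v : Fin n → ℝ} (hv : Function.Injective v) (a : Fin n → ℝ) :
    ({x : Fin n → ℝ | ∑ i, a i * x i = 0} ∩
      {w : Fin n → ℝ | ∃ σ : Perm (Fin n), w = fun i => v (σ⁻¹ i)}).ncard =
    #(hyperplanePerms v a) := by
  rw [inter_orbit_eq_image, Set.ncard_image_of_injective, Set.ncard_coe_finset]
  intro σ τ h
  exact inv_injective (Equiv.ext fun i => hv (congrFun h i))

theorem exists_card_hyperplanePerms_eq {m : ℕ} (hm : 1 ≤ m) {v : Fin (m + 1) → ℝ}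
    (hv : Function.Injective v) (hs : ∑ j, v j ≠ 0) :
    ∃ a : Fin (m + 1) → ℝ, a ≠ 0 ∧ #(hyperplanePerms v a) = m.factorial := by
  refine ⟨fun i => (if i = 0 then ∑ j, v j else 0) - v 0, fun h => ?_, ?_⟩
  · have h0 := congrFun h 0
    have h1 := congrFun h (Fin.last m)
    have hlast : Fin.last m ≠ 0 := by
      rw [Ne, Fin.ext_iff]
      simp
      lia
    simp only [if_true, if_neg hlast, Pi.zero_apply] at h0 h1
    exact hs (by linarith)
  · rw [← card_perm_apply_zero_eq 0]
    congr 1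
    ext σ
    rw [mem_hyperplanePerms_iff_sum_inv, mem_filter]
    simp only [sub_mul, sum_sub_distrib, ite_mul, zero_mul, sum_ite_eq', mem_univ, if_true,
      true_and, ← Finset.mul_sum, Equiv.sum_comp]
    rw [mul_comm, ← sub_mul, mul_eq_zero, or_iff_left hs, sub_eq_zero, hv.eq_iff,
      Perm.inv_eq_iff_eq, eq_comm]

end OrbitHyperplane


/-- Let `n ≥ 2`. There is a nonzero polynomial `F ∈ ℝ[x₁,…,xₙ]` such that
every `v` with `F(v) ≠ 0` has pairwise distinct coordinates and satisfies: (a) for every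
hyperplane `H` through the origin, `|H ∩ Sₙ·v| ≤ (n-1)!`; (b) some hyperplane through the
origin achieves `|H ∩ Sₙ·v| = (n-1)!`. -/
theorem stmt3 (n : ℕ) (hn : 2 ≤ n) :
    ∃ F : MvPolynomial (Fin n) ℝ, F ≠ 0 ∧
      ∀ v : Fin n → ℝ, MvPolynomial.eval v F ≠ 0 →
        (∀ i j : Fin n, i ≠ j → v i ≠ v j) ∧
        (∀ a : Fin n → ℝ, a ≠ 0 →
          ({x : Fin n → ℝ | ∑ i, a i * x i = 0} ∩
            {w : Fin n → ℝ | ∃ σ : Equiv.Perm (Fin n), w = fun i => v (σ⁻¹ i)}).ncard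
            ≤ (n - 1).factorial) ∧
        (∃ a : Fin n → ℝ, a ≠ 0 ∧
          ({x : Fin n → ℝ | ∑ i, a i * x i = 0} ∩
            {w : Fin n → ℝ | ∃ σ : Equiv.Perm (Fin n), w = fun i => v (σ⁻¹ i)}).ncard
            = (n - 1).factorial) := by
  obtain ⟨m, rfl⟩ : ∃ m, n = m + 1 := ⟨n - 1, by lia⟩
  obtain ⟨v₀, -, hv₀⟩ := exists_hasSmallHyperplaneSections m
  obtain ⟨F, hF, hFv⟩ := hv₀.exists_mvPolynomial
  have hsum : (∑ i, MvPolynomial.X i : MvPolynomial (Fin (m + 1)) ℝ) ≠ 0 := fun h => by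
    have := congrArg (MvPolynomial.eval (Pi.single 0 1)) h
    simp at this
  have hdiff : (∏ p : Fin (m + 1) × Fin (m + 1) with p.1 ≠ p.2,
      (MvPolynomial.X p.1 - MvPolynomial.X p.2) : MvPolynomial (Fin (m + 1)) ℝ) ≠ 0 :=
    Finset.prod_ne_zero_iff.2 fun p hp h =>
      (Finset.mem_filter.1 hp).2 (MvPolynomial.X_injective (sub_eq_zero.1 h))
  refine ⟨F * (∑ i, MvPolynomial.X i) * _, mul_ne_zero (mul_ne_zero hF hsum) hdiff, fun v hv => ?_⟩
  rw [map_mul, map_mul, mul_ne_zero_iff, mul_ne_zero_iff, map_prod, Finset.prod_ne_zero_iff,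
    map_sum] at hv
  obtain ⟨⟨hv1, hv2⟩, hv3⟩ := hv
  simp only [MvPolynomial.eval_X] at hv2
  have hne : ∀ i j : Fin (m + 1), i ≠ j → v i ≠ v j := fun i j hij h =>
    hv3 (i, j) (by simpa using hij) (by simp [h])
  have hinj : Function.Injective v := fun i j h => not_not.1 fun hij => hne i j hij h
  simp only [ncard_inter_orbit hinj]
  exact ⟨hne, hFv v hv1, exists_card_hyperplanePerms_eq (by lia) hinj hv2⟩
end

section
/- Let k ≤ n be positive integers. Suppose that for every v ∈ ℝ^n with pairwise distinct coordinates whose coordinates do not sum to 0, and every hyperplane H ⊆ ℝ^n through the origin, |H ∩ S_n·v| ≤ n!/k. Then for every integer m ≥ n, every v ∈ ℝ^m with pairwise distinct coordinates whose coordinates do not sum to 0, and every hyperplane H ⊆ ℝ^m through the origin, |H ∩ S_m·v| ≤ m!/k. -/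
open Finset in
/-- The number of permutations `σ` for which `v ∘ σ` lies on the hyperplane with normal vector `a`
is the number of points of the orbit of `v` on that hyperplane. -/
theorem ncard_hyperplane_inter_orbit {n : ℕ} {v : Fin n → ℝ} (hv : Function.Injective v)
    (a : Fin n → ℝ) :
    ({x : Fin n → ℝ | ∑ i, a i * x i = 0} ∩
      {w : Fin n → ℝ | ∃ σ : Equiv.Perm (Fin n), w = fun i => v (σ⁻¹ i)}).ncard =
      #{σ : Equiv.Perm (Fin n) | ∑ i, a i * v (σ i) = 0} := by
  have himage : {x : Fin n → ℝ | ∑ i, a i * x i = 0} ∩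
      {w : Fin n → ℝ | ∃ σ : Equiv.Perm (Fin n), w = fun i => v (σ⁻¹ i)} =
      (fun (σ : Equiv.Perm (Fin n)) i => v (σ i)) ''
        ({σ : Equiv.Perm (Fin n) | ∑ i, a i * v (σ i) = 0} : Finset (Equiv.Perm (Fin n))) := by
    ext x
    simp only [Set.mem_inter_iff, Set.mem_ofPred_eq, Set.mem_image, coe_filter, mem_univ, true_and]
    constructor
    · rintro ⟨hx, σ, rfl⟩
      exact ⟨σ⁻¹, hx, rfl⟩
    · rintro ⟨σ, hσ, rfl⟩
      exact ⟨hσ, σ⁻¹, by simp⟩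
  rw [himage, Set.ncard_image_of_injective, Set.ncard_coe_finset]
  intro σ τ hστ
  ext1 i
  exact hv (congrFun hστ i)

/-- The permutation of `Fin n` obtained from a permutation of `Fin (n + 1)` sending `i` to `j` by
deleting `i` from the domain and `j` from the codomain. -/
def Equiv.Perm.deleteFin {n : ℕ} (i j : Fin (n + 1)) (σ : Equiv.Perm (Fin (n + 1))) :
    Equiv.Perm (Fin n) :=
  Equiv.removeNone (((finSuccEquiv' i).symm.trans σ).trans (finSuccEquiv' j))

theorem Equiv.Perm.succAbove_deleteFin {n : ℕ} {i j : Fin (n + 1)}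
    {σ : Equiv.Perm (Fin (n + 1))} (hσ : σ i = j) (p : Fin n) :
    j.succAbove (σ.deleteFin i j p) = σ (i.succAbove p) := by
  obtain ⟨q, hq⟩ : ∃ q, j.succAbove q = σ (i.succAbove p) := by
    apply Fin.exists_succAbove_eq
    rw [← hσ]
    exact fun h => Fin.succAbove_ne i p (σ.injective h)
  have hsome : ((((finSuccEquiv' i).symm.trans σ).trans (finSuccEquiv' j)) (some p)) = some q := by
    simp [← hq]
  have hremove : some (σ.deleteFin i j p) = some q := by
    rw [← hsome]
    exact Equiv.removeNone_some _ ⟨q, hsome⟩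
  rw [Option.some_injective _ hremove, hq]

theorem Equiv.Perm.injOn_deleteFin {n : ℕ} (i j : Fin (n + 1)) :
    Set.InjOn (Equiv.Perm.deleteFin i j) {σ | σ i = j} := by
  intro σ hσ τ hτ hστ
  ext1 x
  rcases Fin.eq_self_or_eq_succAbove i x with rfl | ⟨p, rfl⟩
  · exact hσ.trans hτ.symm
  · rw [← succAbove_deleteFin hσ, ← succAbove_deleteFin hτ, hστ]

theorem Equiv.Perm.sum_mul_comp_eq_deleteFin {n : ℕ} {i j : Fin (n + 1)}
    {σ : Equiv.Perm (Fin (n + 1))} (hσ : σ i = j) (a v : Fin (n + 1) → ℝ) :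
    ∑ x, a x * v (σ x) =
      a i * v j + ∑ p, a (i.succAbove p) * v (j.succAbove (σ.deleteFin i j p)) := by
  rw [Fin.sum_univ_succAbove _ i, hσ]
  simp_rw [succAbove_deleteFin hσ]

open Finset in
/-- If `a` is constant away from `i`, all permutations placing `v` on the hyperplane with normal
vector `a` agree at `i`. -/
theorem card_perm_sum_eq_zero_le_factorial {n : ℕ} {a v : Fin (n + 1) → ℝ}
    (hv : Function.Injective v) (hsum : ∑ i, v i ≠ 0) (ha : a ≠ 0) {i : Fin (n + 1)} {c : ℝ}
    (hc : ∀ p, a (i.succAbove p) = c) :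
    #{σ : Equiv.Perm (Fin (n + 1)) | ∑ x, a x * v (σ x) = 0} ≤ n.factorial := by
  have hexpand (σ : Equiv.Perm (Fin (n + 1))) :
      ∑ x, a x * v (σ x) = (a i - c) * v (σ i) + c * ∑ x, v x := by
    rw [← Equiv.sum_comp σ v, Fin.sum_univ_succAbove _ i,
      Fin.sum_univ_succAbove (fun x => v (σ x)) i]
    simp_rw [hc, ← mul_sum]
    ring
  rcases eq_empty_or_nonempty
    ({σ : Equiv.Perm (Fin (n + 1)) | ∑ x, a x * v (σ x) = 0} : Finset _) with hempty | ⟨τ, hτ⟩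
  · simp [hempty]
  have hτ0 : (a i - c) * v (τ i) + c * ∑ x, v x = 0 := by
    rw [← hexpand]
    exact (mem_filter.1 hτ).2
  have hne : a i - c ≠ 0 := by
    intro hi
    have hc0 : c = 0 := by simpa [hi, hsum] using hτ0
    apply ha
    ext x
    rcases Fin.eq_self_or_eq_succAbove i x with rfl | ⟨p, rfl⟩
    · simpa [hc0] using hi
    · simp [hc, hc0]
  calc #{σ : Equiv.Perm (Fin (n + 1)) | ∑ x, a x * v (σ x) = 0}
      ≤ #(univ : Finset (Equiv.Perm (Fin n))) := by
        refine card_le_card_of_injOn (Equiv.Perm.deleteFin i (τ i))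
          (fun _ _ => mem_coe.2 (mem_univ _))
          ((Equiv.Perm.injOn_deleteFin i (τ i)).mono fun σ hσ => ?_)
        have hσ0 := (mem_filter.1 hσ).2
        rw [hexpand] at hσ0
        exact hv (mul_left_cancel₀ hne (by linarith))
    _ = n.factorial := by simp [Fintype.card_perm]

open Finset in
/-- A bound `B` in dimension `n` on the number of permutations placing a vector on a hyperplane gives
the bound `(n + 1) * B` in dimension `n + 1`. -/
theorem card_perm_sum_eq_zero_succ_le {n : ℕ} {B : ℝ}
    (hB : (n.factorial : ℝ) ≤ (n + 1) * B) (hn : 0 < n)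
    (h : ∀ v : Fin n → ℝ, Function.Injective v → ∑ i, v i ≠ 0 → ∀ a : Fin n → ℝ, a ≠ 0 →
      (#{σ : Equiv.Perm (Fin n) | ∑ i, a i * v (σ i) = 0} : ℝ) ≤ B)
    {v : Fin (n + 1) → ℝ} (hv : Function.Injective v) (hsum : ∑ i, v i ≠ 0)
    {a : Fin (n + 1) → ℝ} (ha : a ≠ 0) :
    (#{σ : Equiv.Perm (Fin (n + 1)) | ∑ i, a i * v (σ i) = 0} : ℝ) ≤ (n + 1) * B := by
  by_cases hconst : ∃ (i : Fin (n + 1)) (c : ℝ), ∀ p, a (i.succAbove p) = c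
  · obtain ⟨i, c, hc⟩ := hconst
    exact (Nat.cast_le.2 (card_perm_sum_eq_zero_le_factorial hv hsum ha hc)).trans hB
  push Not at hconst
  obtain ⟨j, hj⟩ : ∃ j, v j ≠ ∑ i, v i := by
    by_contra! hall
    have h01 : (0 : Fin (n + 1)) = Fin.last n := hv ((hall _).trans (hall _).symm)
    simp [Fin.ext_iff] at h01
    omega
  have hrest : ∑ p, v (j.succAbove p) ≠ 0 := by
    intro h0
    rw [Fin.sum_univ_succAbove v j, h0, add_zero] at hj
    exact hj rfl
  have hfiber (i : Fin (n + 1)) :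
      (#{σ ∈ ({σ : Equiv.Perm (Fin (n + 1)) | ∑ x, a x * v (σ x) = 0} : Finset _) |
        σ.symm j = i} : ℝ) ≤ B := by
    set c := a i * v j / ∑ p, v (j.succAbove p) with hcdef
    have hc : c * ∑ p, v (j.succAbove p) = a i * v j := div_mul_cancel₀ _ hrest
    refine le_trans (Nat.cast_le.2 ?_) (h (fun p => v (j.succAbove p))
      (hv.comp Fin.succAbove_right_injective) hrest (fun p => a (i.succAbove p) + c) ?_)
    · apply card_le_card_of_injOn (Equiv.Perm.deleteFin i j)
      · intro σ hσ
        simp only [coe_filter, mem_filter, mem_univ, true_and, Set.mem_ofPred_eq] at hσ ⊢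
        obtain ⟨hσ, hσj⟩ := hσ
        have hσi : σ i = j := ((Equiv.symm_apply_eq σ).1 hσj).symm
        simp_rw [add_mul, sum_add_distrib, ← mul_sum]
        rw [Equiv.sum_comp (σ.deleteFin i j) (fun p => v (j.succAbove p)), hc, add_comm,
          ← Equiv.Perm.sum_mul_comp_eq_deleteFin hσi, hσ]
      · refine (Equiv.Perm.injOn_deleteFin i j).mono fun σ hσ => ?_
        exact ((Equiv.symm_apply_eq σ).1 (mem_filter.1 hσ).2).symm
    · intro h0
      obtain ⟨p, hp⟩ := hconst i (-c)
      exact hp (eq_neg_of_add_eq_zero_left (congrFun h0 p))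
  rw [card_eq_sum_card_fiberwise (f := fun σ : Equiv.Perm (Fin (n + 1)) => σ.symm j) (t := univ)
    (fun _ _ => mem_coe.2 (mem_univ _)), Nat.cast_sum]
  refine (sum_le_card_nsmul _ _ _ fun i _ => hfiber i).trans_eq ?_
  simp

/-- Let `k ≤ n` be positive integers. If for every `v ∈ ℝ^n` with pairwise
distinct coordinates not summing to `0` and every hyperplane `H` through the origin we have
`|H ∩ Sₙ·v| ≤ n!/k`, then for every `m ≥ n`, every such `v ∈ ℝ^m`, and every hyperplane `H`
through the origin in `ℝ^m`, we have `|H ∩ Sₘ·v| ≤ m!/k`. -/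
theorem stmt4 (n k : ℕ) (hk : 0 < k) (hkn : k ≤ n)
    (h : ∀ v : Fin n → ℝ, (∀ i j : Fin n, i ≠ j → v i ≠ v j) → (∑ i, v i ≠ 0) →
      ∀ a : Fin n → ℝ, a ≠ 0 →
        ((({x : Fin n → ℝ | ∑ i, a i * x i = 0} ∩
            {w : Fin n → ℝ | ∃ σ : Equiv.Perm (Fin n), w = fun i => v (σ⁻¹ i)}).ncard : ℝ))
          ≤ (n.factorial : ℝ) / (k : ℝ)) :
    ∀ m : ℕ, n ≤ m →
      ∀ v : Fin m → ℝ, (∀ i j : Fin m, i ≠ j → v i ≠ v j) → (∑ i, v i ≠ 0) →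
        ∀ a : Fin m → ℝ, a ≠ 0 →
          ((({x : Fin m → ℝ | ∑ i, a i * x i = 0} ∩
              {w : Fin m → ℝ | ∃ σ : Equiv.Perm (Fin m), w = fun i => v (σ⁻¹ i)}).ncard : ℝ))
            ≤ (m.factorial : ℝ) / (k : ℝ) := by
  have hcard : ∀ m : ℕ, n ≤ m → ∀ v : Fin m → ℝ, Function.Injective v → ∑ i, v i ≠ 0 →
      ∀ a : Fin m → ℝ, a ≠ 0 →
        (Finset.card {σ : Equiv.Perm (Fin m) | ∑ i, a i * v (σ i) = 0} : ℝ) ≤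
          (m.factorial : ℝ) / k := by
    intro m hm
    induction m, hm using Nat.le_induction with
    | base =>
      intro v hv hsum a ha
      rw [← ncard_hyperplane_inter_orbit hv]
      exact h v (fun i j hij => hv.ne hij) hsum a ha
    | succ m hm ih =>
      intro v hv hsum a ha
      have hfactorial : ((m + 1).factorial : ℝ) / k = (m + 1) * ((m.factorial : ℝ) / k) := by
        rw [Nat.factorial_succ]
        push_cast
        ring
      have hk0 : (0 : ℝ) < k := Nat.cast_pos.2 hk
      have hkm : (k : ℝ) ≤ m + 1 := by exact_mod_cast (hkn.trans hm).trans m.le_succ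
      rw [hfactorial]
      refine card_perm_sum_eq_zero_succ_le ?_ (by omega) ih hv hsum ha
      rw [← mul_div_assoc, le_div_iff₀ hk0, mul_comm]
      gcongr
  intro m hm v hv hsum a ha
  have hinj : Function.Injective v := fun i j hij => by_contra fun hne => hv i j hne hij
  rw [ncard_hyperplane_inter_orbit hinj]
  exact hcard m hm v hinj hsum a ha
end

section
/- Let n ≥ 3, let v ∈ ℝ^n have pairwise distinct coordinates, and let a ∈ ℝ^n. Let σ = (i j k) ∈ S_n be a 3-cycle and let π ∈ S_n be an n-cycle. If for every integer m both π^m·v and σ·π^m·v lie in {x ∈ ℝ^n : Σ_l a_l x_l = 0}, then a_i = a_j = a_k. -/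
/-- If `β` and `γ` have weakly equal signs and every translate of `v` under the powers of a
transitive cycle satisfies `β (v q - v p) + γ (v r - v p) = 0`, then `β = γ = 0`: translate `p` to
the maximum of `v`. -/
lemma coeff_eq_zero_of_forall_zpow {α : Type*} [Fintype α] [DecidableEq α]
    {π : Equiv.Perm α} (hπ : π.IsCycle) (hsupp : π.support = Finset.univ)
    {v : α → ℝ} (hv : Function.Injective v) {p q r : α} (hpq : p ≠ q) (hpr : p ≠ r)
    {β γ : ℝ} (hβγ : 0 ≤ β * γ)
    (h : ∀ m : ℤ, β * (v ((π ^ m)⁻¹ q) - v ((π ^ m)⁻¹ p)) +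
      γ * (v ((π ^ m)⁻¹ r) - v ((π ^ m)⁻¹ p)) = 0) :
    β = 0 ∧ γ = 0 := by
  have : Nonempty α := ⟨p⟩
  obtain ⟨x, hx⟩ := Finite.exists_max v
  have hmem (y : α) : π y ≠ y := by
    rw [← Equiv.Perm.mem_support, hsupp]
    exact Finset.mem_univ y
  obtain ⟨m, hm⟩ := hπ.exists_zpow_eq (hmem x) (hmem p)
  have hxp : (π ^ m)⁻¹ p = x := Equiv.Perm.inv_eq_iff_eq.2 hm.symm
  have hlt {y : α} (hy : p ≠ y) : v ((π ^ m)⁻¹ y) - v x < 0 := by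
    refine sub_neg.2 (lt_of_le_of_ne (hx _) fun he => hy ?_)
    exact ((π ^ m)⁻¹.injective ((hv he).trans hxp.symm)).symm
  have hq := hlt hpq
  have hr := hlt hpr
  have hm' := h m
  rw [hxp] at hm'
  generalize v ((π ^ m)⁻¹ q) - v x = s at *
  generalize v ((π ^ m)⁻¹ r) - v x = t at *
  have hst : 0 < s * t := mul_pos_of_neg_of_neg hq hr
  have hβ : β = 0 := by
    have h1 : (β * s) ^ 2 = -(β * γ) * (s * t) := by linear_combination β * s * hm'
    have h2 : β * s = 0 := by
      have := mul_nonneg hβγ hst.le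
      exact pow_eq_zero_iff two_ne_zero |>.1 (le_antisymm (by linarith) (sq_nonneg _))
    exact (mul_eq_zero.1 h2).resolve_right hq.ne
  refine ⟨hβ, ?_⟩
  rw [hβ, zero_mul, zero_add] at hm'
  exact (mul_eq_zero.1 hm').resolve_right hr.ne

/-- For a 3-cycle `σ = (i j k)`, the difference of the pairings of `a` with `σ · w` and with `w`
only involves the coordinates `i`, `j`, `k`. -/
lemma sum_mul_threeCycle_sub {α : Type*} [Fintype α] [DecidableEq α] (a w : α → ℝ)
    {i j k : α} (hij : i ≠ j) (hjk : j ≠ k) (hik : i ≠ k)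
    {σ : Equiv.Perm α} (hσi : σ i = j) (hσj : σ j = k) (hσk : σ k = i)
    (hσfix : ∀ m, m ≠ i → m ≠ j → m ≠ k → σ m = m) :
    ∑ l, a l * w (σ⁻¹ l) - ∑ l, a l * w l =
      (a j - a i) * w i + (a k - a j) * w j + (a i - a k) * w k := by
  have hre : ∑ l, a l * w (σ⁻¹ l) = ∑ l, a (σ l) * w l := by
    rw [← Equiv.sum_comp σ]
    simp
  rw [hre, ← Finset.sum_sub_distrib, ← Finset.sum_subset (Finset.subset_univ {i, j, k})]
  · rw [Finset.sum_insert (by simp [hij, hik]), Finset.sum_pair hjk, hσi, hσj, hσk]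
    ring
  · intro l _ hl
    simp only [Finset.mem_insert, Finset.mem_singleton, not_or] at hl
    rw [hσfix l hl.1 hl.2.1 hl.2.2, sub_self]

/-- Let `n ≥ 3`, let `v ∈ ℝ^n` have pairwise distinct coordinates, and let
`a ∈ ℝ^n`. Let `σ = (i j k)` be a 3-cycle and `π` an `n`-cycle. If for every integer `m` both
`π^m·v` and `σ·π^m·v` lie on the hyperplane `∑ l, a l * x l = 0`, then `a i = a j = a k`. -/
theorem stmt8 (n : ℕ) (hn : 3 ≤ n) (v a : Fin n → ℝ)
    (hv : ∀ i j : Fin n, i ≠ j → v i ≠ v j)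
    (i j k : Fin n) (hij : i ≠ j) (hjk : j ≠ k) (hik : i ≠ k)
    (σ : Equiv.Perm (Fin n)) (hσi : σ i = j) (hσj : σ j = k) (hσk : σ k = i)
    (hσfix : ∀ m : Fin n, m ≠ i → m ≠ j → m ≠ k → σ m = m)
    (π : Equiv.Perm (Fin n)) (hπ : π.IsCycle) (hπsupp : π.support = Finset.univ)
    (h : ∀ m : ℤ, (∑ l, a l * v ((π ^ m)⁻¹ l) = 0) ∧
        (∑ l, a l * v ((π ^ m)⁻¹ (σ⁻¹ l)) = 0)) :
    a i = a j ∧ a j = a k := by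
  have hinj : Function.Injective v := fun x y hxy => by_contra fun hne => hv x y hne hxy
  have key (m : ℤ) : (a j - a i) * v ((π ^ m)⁻¹ i) + (a k - a j) * v ((π ^ m)⁻¹ j) +
      (a i - a k) * v ((π ^ m)⁻¹ k) = 0 := by
    rw [← sum_mul_threeCycle_sub a (fun l => v ((π ^ m)⁻¹ l)) hij hjk hik hσi hσj hσk hσfix,
      (h m).1, (h m).2, sub_zero]
  have hsign : 0 ≤ (a k - a j) * (a i - a k) ∨ 0 ≤ (a j - a i) * (a i - a k) ∨
      0 ≤ (a j - a i) * (a k - a j) := by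
    by_contra! hneg
    nlinarith [sq_nonneg (a i - a k)]
  rcases hsign with hs | hs | hs
  · obtain ⟨h1, h2⟩ := coeff_eq_zero_of_forall_zpow hπ hπsupp hinj hij hik hs
      fun m => by linear_combination key m
    constructor <;> linarith
  · obtain ⟨h1, h2⟩ := coeff_eq_zero_of_forall_zpow hπ hπsupp hinj hij.symm hjk hs
      fun m => by linear_combination key m
    constructor <;> linarith
  · obtain ⟨h1, h2⟩ := coeff_eq_zero_of_forall_zpow hπ hπsupp hinj hik.symm hjk.symm hs
      fun m => by linear_combination key m
    constructor <;> linarith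
end

section
/- Let p ≥ 3 be a prime and let a = (a_1,…,a_p) ∈ ℝ^p. Suppose there exists an index i such that a_j ≠ a_i for all j ≠ i. Then for every v ∈ ℝ^p with pairwise distinct coordinates, the hyperplane H = {x ∈ ℝ^p : Σ_m a_m x_m = 0} satisfies |H ∩ S_p·v| ≤ (p−1)!. -/
namespace PermOrbit

open Equiv Finset

variable {n : ℕ}

/-- In the list `π 0, …, π n`, the entry `π m = i` and the nearest later entry `π k` with
`a (π k) < a i`. -/
def NearestRight (a : Fin (n + 1) → ℝ) (i : Fin (n + 1)) (π : Perm (Fin (n + 1)))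
    (m k : Fin (n + 1)) : Prop :=
  π m = i ∧ m < k ∧ a (π k) < a i ∧ ∀ r, m < r → r < k → a i < a (π r)

/-- In the list `π 0, …, π n`, the entry `π m = i` and the nearest earlier entry `π k` with
`a i < a (π k)`. -/
def NearestLeft (a : Fin (n + 1) → ℝ) (i : Fin (n + 1)) (π : Perm (Fin (n + 1)))
    (m k : Fin (n + 1)) : Prop :=
  π m = i ∧ k < m ∧ a i < a (π k) ∧ ∀ r, k < r → r < m → a (π r) < a i

/-- The condition deciding whether `i` is moved to the left. -/
def MovesLeft (a : Fin (n + 1) → ℝ) (i : Fin (n + 1)) (π : Perm (Fin (n + 1))) : Prop :=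
  a i < a (π 0) ∧ a i ≤ a (π (Fin.last n))

/-- The condition telling, from the result of a move, that `i` was moved to the left. -/
def MovedLeft (a : Fin (n + 1) → ℝ) (i : Fin (n + 1)) (π : Perm (Fin (n + 1))) : Prop :=
  a i ≤ a (π 0) ∧ a i < a (π (Fin.last n))

/-- The relation between a permutation and the one obtained by moving the entry `i`. -/
def Step (a : Fin (n + 1) → ℝ) (i : Fin (n + 1)) (π ρ : Perm (Fin (n + 1))) : Prop :=
  (¬ MovesLeft a i π ∧ ∃ m k, NearestRight a i π m k ∧ ρ = π * swap m k) ∨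
    (MovesLeft a i π ∧ ∃ m k, NearestLeft a i π m k ∧ ρ = π * swap m k)

/-- The permutations from which no step is possible. -/
def Terminal (a : Fin (n + 1) → ℝ) (i : Fin (n + 1)) (π : Perm (Fin (n + 1))) : Prop :=
  a (π 0) ≤ a i ∧ ∀ m r, π m = i → m < r → a i < a (π r)

variable {a : Fin (n + 1) → ℝ} {i : Fin (n + 1)} {π π₁ π₂ ρ : Perm (Fin (n + 1))}

lemma lt_of_le_of_apply_ne (hi : ∀ j, j ≠ i → a j ≠ a i) {m r : Fin (n + 1)} (hm : π m = i)
    (hr : r ≠ m) (h : a i ≤ a (π r)) : a i < a (π r) :=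
  lt_of_le_of_ne h fun h' => hi (π r) (fun e => hr (π.injective (e.trans hm.symm))) h'.symm

lemma NearestRight.not_movedLeft (hi : ∀ j, j ≠ i → a j ≠ a i) {m k : Fin (n + 1)}
    (h : NearestRight a i π m k) (hπ : ¬ MovesLeft a i π) :
    ¬ MovedLeft a i (π * swap m k) := by
  obtain ⟨hm, hmk, hk, -⟩ := h
  rintro ⟨h0, hl⟩
  rw [Perm.mul_apply] at h0 hl
  have hm0 : 0 ≠ m := by
    rintro rfl
    rw [swap_apply_left] at h0
    exact h0.not_gt hk
  have hkl : Fin.last n ≠ k := by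
    rintro rfl
    rw [swap_apply_right, hm] at hl
    exact hl.ne rfl
  rw [swap_apply_of_ne_of_ne hm0 ((Fin.zero_le m).trans_lt hmk).ne] at h0
  rw [swap_apply_of_ne_of_ne (hmk.trans_le (Fin.le_last k)).ne' hkl] at hl
  exact hπ ⟨lt_of_le_of_apply_ne hi hm hm0 h0, hl.le⟩

lemma NearestLeft.movedLeft (hi : ∀ j, j ≠ i → a j ≠ a i) {m k : Fin (n + 1)}
    (h : NearestLeft a i π m k) (hπ : MovesLeft a i π) :
    MovedLeft a i (π * swap m k) := by
  obtain ⟨hm, hkm, hk, -⟩ := h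
  obtain ⟨h0, hl⟩ := hπ
  rw [MovedLeft, Perm.mul_apply, Perm.mul_apply]
  constructor
  · by_cases hk0 : 0 = k
    · rw [← hk0, swap_apply_right, hm]
    · rw [swap_apply_of_ne_of_ne ((Fin.zero_le k).trans_lt hkm).ne hk0]
      exact h0.le
  · by_cases hml : Fin.last n = m
    · rwa [← hml, swap_apply_left]
    · rw [swap_apply_of_ne_of_ne hml (hkm.trans_le (Fin.le_last m)).ne']
      exact lt_of_le_of_apply_ne hi hm hml hl

lemma eq_of_mul_swap_eq {m₁ k₁ m₂ k₂ : Fin (n + 1)} (h₁ : π₁ m₁ = i) (h₂ : π₂ m₂ = i)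
    (h : π₁ * swap m₁ k₁ = π₂ * swap m₂ k₂) : k₁ = k₂ := by
  have e₁ : (π₁ * swap m₁ k₁) k₁ = i := by simp [h₁]
  have e₂ : (π₂ * swap m₂ k₂) k₂ = i := by simp [h₂]
  rw [← h] at e₂
  exact (π₁ * swap m₁ k₁).injective (e₁.trans e₂.symm)

lemma NearestRight.le_of_mul_swap_eq {m₁ m₂ k : Fin (n + 1)}
    (h₁ : NearestRight a i π₁ m₁ k) (h₂ : NearestRight a i π₂ m₂ k)
    (h : π₁ * swap m₁ k = π₂ * swap m₂ k) : m₂ ≤ m₁ := by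
  by_contra! hlt
  have e := congrArg (fun τ : Perm (Fin (n + 1)) => a (τ m₂)) h
  simp only [Perm.mul_apply, swap_apply_left,
    swap_apply_of_ne_of_ne hlt.ne' h₂.2.1.ne] at e
  have := h₁.2.2.2 m₂ hlt h₂.2.1
  have := h₂.2.2.1
  linarith

lemma NearestLeft.le_of_mul_swap_eq {m₁ m₂ k : Fin (n + 1)}
    (h₁ : NearestLeft a i π₁ m₁ k) (h₂ : NearestLeft a i π₂ m₂ k)
    (h : π₁ * swap m₁ k = π₂ * swap m₂ k) : m₁ ≤ m₂ := by
  by_contra! hlt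
  have e := congrArg (fun τ : Perm (Fin (n + 1)) => a (τ m₂)) h
  simp only [Perm.mul_apply, swap_apply_left,
    swap_apply_of_ne_of_ne hlt.ne h₂.2.1.ne'] at e
  have := h₁.2.2.2 m₂ h₂.2.1 hlt
  have := h₂.2.2.1
  linarith

lemma Step.left_unique (hi : ∀ j, j ≠ i → a j ≠ a i) (h₁ : Step a i π₁ ρ)
    (h₂ : Step a i π₂ ρ) : π₁ = π₂ := by
  rcases h₁ with ⟨c₁, m₁, k₁, h₁, e₁⟩ | ⟨c₁, m₁, k₁, h₁, e₁⟩ <;>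
    rcases h₂ with ⟨c₂, m₂, k₂, h₂, e₂⟩ | ⟨c₂, m₂, k₂, h₂, e₂⟩ <;>
    have e := e₁.symm.trans e₂
  · obtain rfl := eq_of_mul_swap_eq h₁.1 h₂.1 e
    obtain rfl := le_antisymm (h₂.le_of_mul_swap_eq h₁ e.symm) (h₁.le_of_mul_swap_eq h₂ e)
    exact mul_right_cancel e
  · exact absurd (h₂.movedLeft hi c₂) (e ▸ h₁.not_movedLeft hi c₁)
  · exact absurd (h₁.movedLeft hi c₁) (e ▸ h₂.not_movedLeft hi c₂)
  · obtain rfl := eq_of_mul_swap_eq h₁.1 h₂.1 e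
    obtain rfl := le_antisymm (h₁.le_of_mul_swap_eq h₂ e) (h₂.le_of_mul_swap_eq h₁ e.symm)
    exact mul_right_cancel e

lemma exists_step (hi : ∀ j, j ≠ i → a j ≠ a i) (hπ : ¬ Terminal a i π) :
    ∃ ρ, Step a i π ρ := by
  classical
  obtain ⟨m, hm⟩ := π.surjective i
  by_cases hL : MovesLeft a i π
  · let s : Finset (Fin (n + 1)) := {r | r < m ∧ a i < a (π r)}
    have hs : s.Nonempty := by
      refine ⟨0, by
        simp only [s, mem_filter, mem_univ, true_and]
        refine ⟨Fin.pos_iff_ne_zero.2 ?_, hL.1⟩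
        rintro rfl
        exact hL.1.ne (by rw [hm])⟩
    have hk := s.max'_mem hs
    simp only [s, mem_filter, mem_univ, true_and] at hk
    refine ⟨_, Or.inr ⟨hL, m, s.max' hs, ⟨hm, hk.1, hk.2, fun r hr hrm => ?_⟩, rfl⟩⟩
    by_contra! hc
    exact hr.not_ge (s.le_max' r (by
      simpa [s] using ⟨hrm, lt_of_le_of_apply_ne hi hm hrm.ne hc⟩))
  · let s : Finset (Fin (n + 1)) := {r | m < r ∧ a (π r) < a i}
    have hs : s.Nonempty := by
      by_contra! hs
      have hR : ∀ r, m < r → a i < a (π r) := by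
        intro r hr
        refine lt_of_le_of_apply_ne hi hm hr.ne' (le_of_not_gt fun hlt => ?_)
        have : r ∈ s := by simpa [s] using ⟨hr, hlt⟩
        simp [hs] at this
      have hlast : a i ≤ a (π (Fin.last n)) := by
        rcases (Fin.le_last m).eq_or_lt with h | h
        · rw [← h, hm]
        · exact (hR _ h).le
      refine hπ ⟨le_of_not_gt fun h => hL ⟨h, hlast⟩, fun m' r hm' hr => hR r ?_⟩
      rwa [π.injective (hm.trans hm'.symm)]
    have hk := s.min'_mem hs
    simp only [s, mem_filter, mem_univ, true_and] at hk
    refine ⟨_, Or.inl ⟨hL, m, s.min' hs, ⟨hm, hk.1, hk.2, fun r hmr hr => ?_⟩, rfl⟩⟩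
    refine lt_of_le_of_apply_ne hi hm hmr.ne' (le_of_not_gt fun hc => ?_)
    exact hr.not_ge (s.min'_le r (by simpa [s] using ⟨hmr, hc⟩))

lemma sum_mul_swap_sub (a u : Fin (n + 1) → ℝ) (π : Perm (Fin (n + 1))) {m k : Fin (n + 1)}
    (hmk : m ≠ k) :
    ∑ r, a ((π * swap m k) r) * u r - ∑ r, a (π r) * u r
      = (a (π k) - a (π m)) * (u m - u k) := by
  rw [← Finset.sum_sub_distrib, Fintype.sum_eq_add m k hmk]
  · simp only [Perm.mul_apply, swap_apply_left, swap_apply_right]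
    ring
  · rintro r ⟨h₁, h₂⟩
    rw [Perm.mul_apply, swap_apply_of_ne_of_ne h₁ h₂, sub_self]

lemma Step.sum_lt {u : Fin (n + 1) → ℝ} (hu : StrictMono u) (h : Step a i π ρ) :
    ∑ r, a (π r) * u r < ∑ r, a (ρ r) * u r := by
  rw [← sub_pos]
  rcases h with ⟨-, m, k, ⟨rfl, hmk, hk, -⟩, rfl⟩ | ⟨-, m, k, ⟨rfl, hkm, hk, -⟩, rfl⟩
  · rw [sum_mul_swap_sub a u π hmk.ne]
    exact mul_pos_of_neg_of_neg (sub_neg.2 hk) (sub_neg.2 (hu hmk))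
  · rw [sum_mul_swap_sub a u π hkm.ne']
    exact mul_pos (sub_pos.2 hk) (sub_pos.2 (hu hkm))

/-- Two terminal permutations that are cyclic rotations of each other have `i` at the same
place. -/
lemma Terminal.le_of_rotate (h₁ : Terminal a i π₁) (h₂ : Terminal a i π₂)
    {d m₁ m₂ : Fin (n + 1)} (hm₁ : π₁ m₁ = i) (hm₂ : π₂ m₂ = i)
    (h : ∀ x, π₂ x = π₁ (x + d)) : m₁ ≤ m₂ := by
  by_contra! hlt
  have hd : m₁ = m₂ + d := π₁.injective (by rw [← h, hm₁, hm₂])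
  have hd' : d = m₁ - m₂ := by rw [hd]; abel
  have hdv : (d : ℕ) = m₁ - m₂ := by rw [hd', Fin.sub_val_of_le hlt.le]
  have hneg : m₂ < -d := by
    have hd0 : d ≠ 0 := by
      rintro rfl
      simp at hdv
      omega
    rw [Fin.lt_def, Fin.val_neg, if_neg hd0]
    omega
  have := h₂.2 m₂ (-d) hm₂ hneg
  rw [h, neg_add_cancel] at this
  exact this.not_ge h₁.1

open Classical in
lemma card_terminal_le (a : Fin (n + 1) → ℝ) (i : Fin (n + 1)) :
    #{π : Perm (Fin (n + 1)) | Terminal a i π} ≤ n.factorial := by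
  let s : Finset (Perm (Fin (n + 1))) := {π | Terminal a i π}
  have hinj : Set.InjOn
      (fun q : Fin (n + 1) × Perm (Fin (n + 1)) => (Equiv.addRight q.1).trans q.2)
      ((univ : Finset (Fin (n + 1))) ×ˢ s : Finset _) := by
    rintro ⟨k₁, π₁⟩ h₁ ⟨k₂, π₂⟩ h₂ h
    simp only [s, coe_product, Set.mem_prod, mem_coe, mem_filter, mem_univ, true_and] at h₁ h₂
    have hx : ∀ x, π₁ (x + k₁) = π₂ (x + k₂) := fun x => Equiv.congr_fun h x
    have h₂₁ : ∀ x, π₂ x = π₁ (x + (k₁ - k₂)) := fun x => by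
      have := hx (x - k₂)
      rw [sub_add_cancel] at this
      rw [← this]
      congr 1
      abel
    have h₁₂ : ∀ x, π₁ x = π₂ (x + (k₂ - k₁)) := fun x => by
      rw [h₂₁]
      congr 1
      abel
    obtain ⟨m₁, hm₁⟩ := π₁.surjective i
    obtain ⟨m₂, hm₂⟩ := π₂.surjective i
    obtain rfl := le_antisymm (h₁.le_of_rotate h₂ hm₁ hm₂ h₂₁) (h₂.le_of_rotate h₁ hm₂ hm₁ h₁₂)
    have hk : m₁ = m₁ + (k₁ - k₂) := π₁.injective (by rw [← h₂₁, hm₁, hm₂])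
    obtain rfl : k₁ = k₂ := sub_eq_zero.1 (left_eq_add.1 hk)
    simp only [Prod.mk.injEq, true_and]
    ext x
    rw [h₁₂ x]
    simp
  have hcard := card_le_card_of_injOn _ (fun q _ => mem_univ _) hinj
  rw [card_product, card_univ, card_univ, Fintype.card_perm, Fintype.card_fin,
    Nat.factorial_succ] at hcard
  exact Nat.le_of_mul_le_mul_left hcard n.succ_pos

open Classical in
lemma card_sum_eq_zero_le (hi : ∀ j, j ≠ i → a j ≠ a i) {u : Fin (n + 1) → ℝ}
    (hu : StrictMono u) :
    #{π : Perm (Fin (n + 1)) | ∑ r, a (π r) * u r = 0} ≤ n.factorial := by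
  choose! φ hφ using fun (π : Perm (Fin (n + 1))) (h : ¬ Terminal a i π) => exists_step hi h
  let F : Perm (Fin (n + 1)) → ℝ := fun π => ∑ r, a (π r) * u r
  have hmoved : #{π | 0 ≤ F π ∧ ¬ Terminal a i π} ≤ #{π | 0 < F π} := by
    refine card_le_card_of_injOn φ (fun π hπ => ?_) (fun π₁ h₁ π₂ h₂ h => ?_)
    · simp only [coe_filter, mem_univ, true_and, Set.mem_ofPred_eq] at hπ ⊢
      exact hπ.1.trans_lt ((hφ π hπ.2).sum_lt hu)
    · simp only [coe_filter, mem_univ, true_and, Set.mem_ofPred_eq] at h₁ h₂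
      exact (hφ π₁ h₁.2).left_unique hi (h ▸ hφ π₂ h₂.2)
  have hnonneg : #{π | 0 ≤ F π} ≤ #{π | 0 ≤ F π ∧ ¬ Terminal a i π} + n.factorial := by
    refine le_trans ?_ (Nat.add_le_add_left (card_terminal_le a i) _)
    refine (card_le_card fun π hπ => ?_).trans (card_union_le _ _)
    by_cases h : Terminal a i π <;> simp_all
  have hsplit : #{π | F π = 0} + #{π | 0 < F π} = #{π | 0 ≤ F π} := by
    rw [← card_union_of_disjoint]
    · congr 1
      ext π
      simp [le_iff_eq_or_lt, eq_comm]
    · exact disjoint_filter.2 fun π _ h h' => h'.ne' h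
  change #{π | F π = 0} ≤ _
  omega

end PermOrbit


/-- Let `p ≥ 3` be prime and `a ∈ ℝ^p`. If there is an index `i` with
`a j ≠ a i` for all `j ≠ i`, then for every `v ∈ ℝ^p` with pairwise distinct coordinates,
the hyperplane `H = {x | ∑ m, a m * x m = 0}` satisfies `|H ∩ Sₚ·v| ≤ (p-1)!`. -/
theorem stmt9 (p : ℕ) (hp : p.Prime) (hp3 : 3 ≤ p)
    (a : Fin p → ℝ) (i : Fin p) (hi : ∀ j : Fin p, j ≠ i → a j ≠ a i)
    (v : Fin p → ℝ) (hv : ∀ i' j' : Fin p, i' ≠ j' → v i' ≠ v j') :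
    ({x : Fin p → ℝ | ∑ m, a m * x m = 0} ∩
      {w : Fin p → ℝ | ∃ σ : Equiv.Perm (Fin p), w = fun m => v (σ⁻¹ m)}).ncard
      ≤ (p - 1).factorial := by
  classical
  obtain ⟨n, rfl⟩ : ∃ n, p = n + 1 := ⟨p - 1, by omega⟩
  let s := Tuple.sort v
  have hvinj : Function.Injective v := fun x y h => by_contra fun hxy => hv x y hxy h
  have hu : StrictMono (v ∘ s) :=
    (Tuple.monotone_sort v).strictMono_of_injective (hvinj.comp s.injective)
  let T : Finset (Equiv.Perm (Fin (n + 1))) := {π | ∑ r, a (π r) * (v ∘ s) r = 0}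
  refine le_trans ?_ (PermOrbit.card_sum_eq_zero_le hi hu)
  refine (Set.ncard_le_ncard (t := (T.image fun π m => v (s (π⁻¹ m)) : Finset _)) ?_
    (Finset.finite_toSet _)).trans ?_
  · rintro _ ⟨hw, σ, rfl⟩
    simp only [Finset.coe_image, Set.mem_image, Finset.mem_coe]
    refine ⟨σ * s, ?_, by simp⟩
    simp only [T, Finset.mem_filter, Finset.mem_univ, true_and]
    have hw' : ∑ m, a m * v (σ⁻¹ m) = 0 := hw
    rw [← Equiv.sum_comp (σ * s)] at hw'
    simpa using hw'
  · rw [Set.ncard_coe_finset]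
    exact Finset.card_image_le
end

section
/- Let p ≥ 5 be a prime and let a = (a_1,…,a_p) ∈ ℝ^p. Suppose there are distinct indices i_1,…,i_s and distinct indices j_1,…,j_t such that a_{i_1} = … = a_{i_s}, a_{j_1} = … = a_{j_t}, a_{i_1} ≠ a_{j_1}, and s·t ≥ p−1. Then for every v ∈ ℝ^p with pairwise distinct coordinates, the hyperplane H = {x ∈ ℝ^p : Σ_m a_m x_m = 0} satisfies |H ∩ S_p·v| ≤ (p−1)!. -/
open Equiv Finset

section Abstract

variable {P : Type*} [Fintype P]

/-- If `E` strictly raises `F`, raises the degree by one, and satisfies an `sl₂`-type commutation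
relation with its adjoint `E'`, then a level set of `F` is no larger than the middle degree. -/
theorem card_zero_le_card_middle (E E' : (P → ℝ) →ₗ[ℝ] (P → ℝ)) (deg : P → ℕ) (D : ℕ) (F : P → ℝ)
    (hadj : ∀ f g, ∑ x, E f x * g x = ∑ x, f x * E' g x)
    (hcomm : ∀ f x, E (E' f) x - E' (E f) x = (2 * (deg x : ℝ) - D) * f x)
    (hE : ∀ f x, E f x ≠ 0 → ∃ y, f y ≠ 0 ∧ F y < F x ∧ deg x = deg y + 1)
    (hE' : ∀ f x, E' f x ≠ 0 → ∃ y, f y ≠ 0 ∧ deg y = deg x + 1) :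
    Fintype.card {x // F x = 0} ≤ Fintype.card {x // deg x = (D + 1) / 2} := by
  classical
  set h := (D + 1) / 2 with hh
  have norm_sub (f : P → ℝ) : ∑ x, E' f x * E' f x - ∑ x, E f x * E f x =
      ∑ x, (2 * (deg x : ℝ) - D) * (f x * f x) := by
    rw [hadj f (E f), ← hadj (E' f) f, ← Finset.sum_sub_distrib]
    refine Finset.sum_congr rfl fun x _ => ?_
    linear_combination f x * hcomm f x
  have E_inj (f : P → ℝ) (hf : ∀ x, h ≤ deg x → f x = 0) (h0 : E f = 0) : f = 0 := by
    have key := norm_sub f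
    have h1 : 0 ≤ ∑ x, E' f x * E' f x := Finset.sum_nonneg fun x _ => mul_self_nonneg _
    have term (x : P) : 0 ≤ ((D : ℝ) - 2 * deg x) * (f x * f x) := by
      by_cases hx : h ≤ deg x
      · simp [hf x hx]
      · have : 2 * deg x ≤ D := by omega
        have : (2 : ℝ) * deg x ≤ D := by exact_mod_cast this
        exact mul_nonneg (by linarith) (mul_self_nonneg _)
    have h3 : ∑ x, ((D : ℝ) - 2 * deg x) * (f x * f x) = 0 := by
      refine le_antisymm ?_ (Finset.sum_nonneg fun x _ => term x)
      have : ∑ x, ((D : ℝ) - 2 * deg x) * (f x * f x) =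
          - ∑ x, (2 * (deg x : ℝ) - D) * (f x * f x) := by
        rw [← Finset.sum_neg_distrib]
        exact Finset.sum_congr rfl fun x _ => by ring
      rw [this, ← key]
      simp only [h0, Pi.zero_apply, mul_zero, Finset.sum_const_zero, sub_zero]
      linarith
    funext x
    by_cases hx : h ≤ deg x
    · exact hf x hx
    · have hz := (Finset.sum_eq_zero_iff_of_nonneg fun x _ => term x).1 h3 x (Finset.mem_univ x)
      have : 2 * deg x < D := by omega
      have : (2 : ℝ) * deg x < D := by exact_mod_cast this
      rcases mul_eq_zero.1 hz with h4 | h4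
      · linarith
      · exact mul_self_eq_zero.1 h4
  have E'_inj (f : P → ℝ) (hf : ∀ x, deg x ≤ h → f x = 0) (h0 : E' f = 0) : f = 0 := by
    have key := norm_sub f
    have h1 : 0 ≤ ∑ x, E f x * E f x := Finset.sum_nonneg fun x _ => mul_self_nonneg _
    have term (x : P) : 0 ≤ (2 * (deg x : ℝ) - D) * (f x * f x) := by
      by_cases hx : deg x ≤ h
      · simp [hf x hx]
      · have : D ≤ 2 * deg x := by omega
        have : (D : ℝ) ≤ 2 * deg x := by exact_mod_cast this
        exact mul_nonneg (by linarith) (mul_self_nonneg _)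
    have h3 : ∑ x, (2 * (deg x : ℝ) - D) * (f x * f x) = 0 := by
      refine le_antisymm ?_ (Finset.sum_nonneg fun x _ => term x)
      rw [← key]
      simp only [h0, Pi.zero_apply, mul_zero, Finset.sum_const_zero]
      linarith
    funext x
    by_cases hx : deg x ≤ h
    · exact hf x hx
    · have hz := (Finset.sum_eq_zero_iff_of_nonneg fun x _ => term x).1 h3 x (Finset.mem_univ x)
      have : D < 2 * deg x := by omega
      have : (D : ℝ) < 2 * deg x := by exact_mod_cast this
      rcases mul_eq_zero.1 hz with h4 | h4
      · linarith
      · exact mul_self_eq_zero.1 h4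
  have ker_supp (f : P → ℝ) (h0 : E f = 0) (x : P) (hx : deg x < h) : f x = 0 := by
    set g : P → ℝ := fun x => if deg x < h then f x else 0 with hg
    have hEg : E g = 0 := by
      funext y
      by_contra hy
      obtain ⟨z, hz, -, hdz⟩ := hE g y hy
      have hz' : deg z < h := by
        by_contra hcon
        exact hz (by simp [hg, hcon])
      have : E (f - g) y ≠ 0 := by
        rw [map_sub, h0]
        simpa using hy
      obtain ⟨w, hw, -, hdw⟩ := hE (f - g) y this
      exact hw (by simp [hg, show deg w < h by omega])
    have := congrFun (E_inj g (fun y hy => by simp [hg, hy]) hEg) x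
    simpa [hg, hx] using this
  let T : (P → ℝ) × (P → ℝ) →ₗ[ℝ] ({x // F x ≠ 0} → ℝ) × ({x // deg x ≤ h} → ℝ) ×
      ({x // h ≤ deg x} → ℝ) :=
    { toFun := fun q => (fun x => if F x < 0 then q.1 x else E q.1 x, fun x => q.2 x,
        fun x => q.1 x + E' q.2 x)
      map_add' := fun q r => by
        refine Prod.ext (funext fun x => ?_) (Prod.ext (funext fun x => ?_) (funext fun x => ?_))
        · by_cases hx : F x < 0 <;> simp [hx]
        · simp
        · simp; ring
      map_smul' := fun c q => by
        refine Prod.ext (funext fun x => ?_) (Prod.ext (funext fun x => ?_) (funext fun x => ?_))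
        · by_cases hx : F x < 0 <;> simp [hx]
        · simp
        · simp; ring }
  have hT : Function.Injective T := by
    rw [← LinearMap.ker_eq_bot, LinearMap.ker_eq_bot']
    rintro ⟨f, u⟩ hfu
    have h1 (x : P) (hx : F x ≠ 0) : (if F x < 0 then f x else E f x) = 0 :=
      congrFun (congrArg Prod.fst hfu) ⟨x, hx⟩
    have h2 (x : P) (hx : deg x ≤ h) : u x = 0 :=
      congrFun (congrArg (fun q => q.2.1) hfu) ⟨x, hx⟩
    have h3 (x : P) (hx : h ≤ deg x) : f x + E' u x = 0 :=
      congrFun (congrArg (fun q => q.2.2) hfu) ⟨x, hx⟩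
    have hEf : E f = 0 := by
      funext x
      by_contra hx
      obtain ⟨y, hy, hlt, -⟩ := hE f x hx
      have hy0 : 0 ≤ F y := by
        by_contra hcon
        push Not at hcon
        have := h1 y hcon.ne
        rw [if_pos hcon] at this
        exact hy this
      have hx0 : 0 < F x := lt_of_le_of_lt hy0 hlt
      have := h1 x hx0.ne'
      rw [if_neg hx0.not_gt] at this
      exact hx this
    have h4 (x : P) : f x = - E' u x := by
      by_cases hx : h ≤ deg x
      · linarith [h3 x hx]
      · rw [ker_supp f hEf x (by omega)]
        by_contra hcon
        obtain ⟨y, hy, hdy⟩ := hE' u x (fun h' => hcon (by simp [h']))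
        exact hy (h2 y (by omega))
    have h5 : ∑ x, E' u x * E' u x = 0 := by
      have := hadj f u
      simp only [hEf, Pi.zero_apply, zero_mul, Finset.sum_const_zero] at this
      rw [Finset.sum_congr rfl fun x _ => by rw [h4 x, neg_mul], Finset.sum_neg_distrib] at this
      linarith
    have h6 : E' u = 0 := funext fun x => mul_self_eq_zero.1
      ((Finset.sum_eq_zero_iff_of_nonneg fun x _ => mul_self_nonneg _).1 h5 x (Finset.mem_univ x))
    refine Prod.ext (funext fun x => ?_) (E'_inj u h2 h6)
    simp [h4 x, h6]
  have hdim := LinearMap.finrank_le_finrank_of_injective hT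
  simp only [Module.finrank_prod, Module.finrank_fintype_fun_eq_card] at hdim
  have c1 := Fintype.card_subtype_compl (fun x => F x = 0)
  have c1' := Fintype.card_subtype_le (fun x => F x = 0)
  have c2 : Fintype.card {x // deg x ≤ h} + Fintype.card {x // h ≤ deg x} =
      Fintype.card P + Fintype.card {x // deg x = h} := by
    simp only [Fintype.card_subtype]
    rw [← Finset.card_union_add_card_inter, ← Finset.filter_or, ← Finset.filter_and]
    congr 1
    · rw [Finset.filter_true_of_mem fun x _ => le_total _ _, Finset.card_univ]
    · congr 1
      ext x
      simp [le_antisymm_iff]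
  change Fintype.card {x // F x ≠ 0} = _ at c1
  omega

end Abstract

section Permutations

variable {n : ℕ} (K : Finset (Fin (n + 1)))

/-- The transposition of the adjacent values `r` and `r + 1`. -/
def adjSwap (r : Fin n) : Perm (Fin (n + 1)) := swap r.castSucc r.succ

/-- The sum of the values of a permutation on `K`. -/
def blockSum (τ : Perm (Fin (n + 1))) : ℕ := ∑ m ∈ K, (τ m : ℕ)

/-- The indicator that the value `q` is taken on `K` and the value `r` off `K`. -/
noncomputable def splitInd (q r : Fin (n + 1)) (τ : Perm (Fin (n + 1))) : ℝ :=
  if τ.symm q ∈ K ∧ τ.symm r ∉ K then 1 else 0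

/-- The matrix coefficients of the principal `sl₂`. -/
noncomputable def sl2Weight (r : Fin n) : ℝ := √(((r : ℝ) + 1) * (n - r))

/-- Raises one value on `K` by one, exchanging it with a value off `K`. -/
noncomputable def raiseOp :
    (Perm (Fin (n + 1)) → ℝ) →ₗ[ℝ] (Perm (Fin (n + 1)) → ℝ) where
  toFun f τ := ∑ r : Fin n, sl2Weight r * splitInd K r.succ r.castSucc τ * f (adjSwap r * τ)
  map_add' f g := by
    funext τ
    simp [mul_add, Finset.sum_add_distrib]
  map_smul' c f := by
    funext τ
    simp only [Pi.smul_apply, smul_eq_mul, RingHom.id_apply, Finset.mul_sum]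
    exact Finset.sum_congr rfl fun r _ => by ring

/-- Lowers one value on `K` by one, exchanging it with a value off `K`. -/
noncomputable def lowerOp :
    (Perm (Fin (n + 1)) → ℝ) →ₗ[ℝ] (Perm (Fin (n + 1)) → ℝ) where
  toFun f τ := ∑ r : Fin n, sl2Weight r * splitInd K r.castSucc r.succ τ * f (adjSwap r * τ)
  map_add' f g := by
    funext τ
    simp [mul_add, Finset.sum_add_distrib]
  map_smul' c f := by
    funext τ
    simp only [Pi.smul_apply, smul_eq_mul, RingHom.id_apply, Finset.mul_sum]
    exact Finset.sum_congr rfl fun r _ => by ring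

theorem raiseOp_apply (f : Perm (Fin (n + 1)) → ℝ) (τ : Perm (Fin (n + 1))) :
    raiseOp K f τ =
      ∑ r : Fin n, sl2Weight r * splitInd K r.succ r.castSucc τ * f (adjSwap r * τ) := rfl

theorem lowerOp_apply (f : Perm (Fin (n + 1)) → ℝ) (τ : Perm (Fin (n + 1))) :
    lowerOp K f τ =
      ∑ r : Fin n, sl2Weight r * splitInd K r.castSucc r.succ τ * f (adjSwap r * τ) := rfl

theorem adjSwap_mul_adjSwap_mul (r : Fin n) (τ : Perm (Fin (n + 1))) :
    adjSwap r * (adjSwap r * τ) = τ := by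
  simp [adjSwap, ← mul_assoc]

theorem adjSwap_mul_symm_apply (r : Fin n) (τ : Perm (Fin (n + 1))) (x : Fin (n + 1)) :
    (adjSwap r * τ).symm x = τ.symm (adjSwap r x) := by
  rw [Equiv.symm_apply_eq, Perm.mul_apply, Equiv.apply_symm_apply, adjSwap, ← Perm.mul_apply, swap_mul_self, Perm.one_apply]

theorem splitInd_adjSwap_mul (q s : Fin (n + 1)) (r : Fin n) (τ : Perm (Fin (n + 1))) :
    splitInd K q s (adjSwap r * τ) = splitInd K (adjSwap r q) (adjSwap r s) τ := by
  simp only [splitInd, adjSwap_mul_symm_apply]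

theorem adjSwap_castSucc (r : Fin n) : adjSwap r r.castSucc = r.succ := swap_apply_left _ _

theorem adjSwap_succ (r : Fin n) : adjSwap r r.succ = r.castSucc := swap_apply_right _ _

theorem sum_raiseOp_mul (f g : Perm (Fin (n + 1)) → ℝ) :
    ∑ τ, raiseOp K f τ * g τ = ∑ τ, f τ * lowerOp K g τ := by
  simp only [raiseOp_apply, lowerOp_apply, Finset.sum_mul, Finset.mul_sum]
  rw [Finset.sum_comm, Finset.sum_comm (s := univ (α := Perm (Fin (n + 1))))]
  refine Finset.sum_congr rfl fun r _ => ?_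
  rw [← Equiv.sum_comp (Equiv.mulLeft (adjSwap r))]
  refine Finset.sum_congr rfl fun τ _ => ?_
  simp only [Equiv.coe_mulLeft, adjSwap_mul_adjSwap_mul, splitInd_adjSwap_mul,
    adjSwap_castSucc, adjSwap_succ]
  ring

theorem splitInd_mul_adjSwap_comm {r q : Fin n} (hrq : r ≠ q) (f : Perm (Fin (n + 1)) → ℝ)
    (τ : Perm (Fin (n + 1))) :
    splitInd K r.succ r.castSucc τ * (splitInd K q.castSucc q.succ (adjSwap r * τ) *
        f (adjSwap q * (adjSwap r * τ))) =
      splitInd K q.castSucc q.succ τ * (splitInd K r.succ r.castSucc (adjSwap q * τ) *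
        f (adjSwap r * (adjSwap q * τ))) := by
  rw [splitInd_adjSwap_mul, splitInd_adjSwap_mul]
  by_cases h1 : r.succ = q.castSucc
  · have e1 : adjSwap r q.castSucc = r.castSucc := by rw [← h1, adjSwap_succ]
    have e2 : adjSwap q r.succ = q.succ := by rw [h1, adjSwap_castSucc]
    rw [e1, e2]
    simp only [splitInd]
    by_cases h : τ.symm r.castSucc ∈ K <;> by_cases h' : τ.symm q.succ ∈ K <;> simp [h, h']
  by_cases h2 : q.succ = r.castSucc
  · have e1 : adjSwap r q.succ = r.succ := by rw [h2, adjSwap_castSucc]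
    have e2 : adjSwap q r.castSucc = q.castSucc := by rw [← h2, adjSwap_succ]
    rw [e1, e2]
    simp only [splitInd]
    by_cases h : τ.symm r.succ ∈ K <;> by_cases h' : τ.symm q.castSucc ∈ K <;> simp [h, h']
  have h3 : r.castSucc ≠ q.castSucc := by simpa using hrq
  have h4 : r.succ ≠ q.succ := by simpa using hrq
  have hc : adjSwap q * (adjSwap r * τ) = adjSwap r * (adjSwap q * τ) := by
    rw [← mul_assoc, ← mul_assoc]
    congr 1
    exact Perm.Disjoint.commute (Perm.disjoint_swap_swap (by
      simp [Fin.castSucc_lt_succ.ne, hrq.symm, h2, Ne.symm h1]))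
  have e1 : adjSwap r q.castSucc = q.castSucc := swap_apply_of_ne_of_ne h3.symm (Ne.symm h1)
  have e2 : adjSwap r q.succ = q.succ := swap_apply_of_ne_of_ne h2 h4.symm
  have e3 : adjSwap q r.castSucc = r.castSucc := swap_apply_of_ne_of_ne h3 (Ne.symm h2)
  have e4 : adjSwap q r.succ = r.succ := swap_apply_of_ne_of_ne h1 h4
  rw [e1, e2, e3, e4, hc]
  ring

theorem sl2Weight_mul_self (r : Fin n) : sl2Weight r * sl2Weight r = ((r : ℝ) + 1) * (n - r) := by
  refine Real.mul_self_sqrt (mul_nonneg (by positivity) ?_)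
  have : ((r : ℕ) : ℝ) ≤ n := by exact_mod_cast r.2.le
  linarith

theorem sum_sl2Weight_mul_sub (χ : Fin (n + 1) → ℝ) :
    ∑ r : Fin n, ((r : ℝ) + 1) * (n - r) * (χ r.succ - χ r.castSucc) =
      ∑ q : Fin (n + 1), (2 * (q : ℝ) - n) * χ q := by
  have h1 : ∑ r : Fin n, ((r : ℝ) + 1) * (n - r) * χ r.succ =
      ∑ q : Fin (n + 1), (q : ℝ) * (n + 1 - q) * χ q := by
    rw [Fin.sum_univ_succ]
    simp only [Fin.val_zero, Nat.cast_zero, zero_mul, zero_add, Fin.val_succ, Nat.cast_add,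
      Nat.cast_one]
    exact Finset.sum_congr rfl fun r _ => by ring
  have h2 : ∑ r : Fin n, ((r : ℝ) + 1) * (n - r) * χ r.castSucc =
      ∑ q : Fin (n + 1), ((q : ℝ) + 1) * (n - q) * χ q := by
    rw [Fin.sum_univ_castSucc]
    simp
  simp only [mul_sub, Finset.sum_sub_distrib] at *
  rw [h1, h2, ← Finset.sum_sub_distrib]
  exact Finset.sum_congr rfl fun r _ => by ring

theorem raiseOp_lowerOp_sub (f : Perm (Fin (n + 1)) → ℝ) (τ : Perm (Fin (n + 1))) :
    raiseOp K (lowerOp K f) τ - lowerOp K (raiseOp K f) τ =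
      (2 * (blockSum K τ : ℝ) - (K.card * n : ℕ)) * f τ := by
  simp only [raiseOp_apply, lowerOp_apply, Finset.mul_sum]
  rw [Finset.sum_comm (γ := Fin n), ← Finset.sum_sub_distrib]
  simp only [← Finset.sum_sub_distrib]
  have diag (q : Fin n) : ∑ r : Fin n, (sl2Weight r * splitInd K r.succ r.castSucc τ *
        (sl2Weight q * splitInd K q.castSucc q.succ (adjSwap r * τ) *
          f (adjSwap q * (adjSwap r * τ))) -
      sl2Weight q * splitInd K q.castSucc q.succ τ *
        (sl2Weight r * splitInd K r.succ r.castSucc (adjSwap q * τ) *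
          f (adjSwap r * (adjSwap q * τ)))) =
      ((q : ℝ) + 1) * (n - q) * ((if τ.symm q.succ ∈ K then 1 else 0) -
        (if τ.symm q.castSucc ∈ K then 1 else 0)) * f τ := by
    rw [Finset.sum_eq_single q]
    · simp only [splitInd_adjSwap_mul, adjSwap_castSucc, adjSwap_succ, adjSwap_mul_adjSwap_mul]
      rw [← sl2Weight_mul_self]
      simp only [splitInd]
      by_cases h1 : τ.symm q.succ ∈ K <;> by_cases h2 : τ.symm q.castSucc ∈ K <;> simp [h1, h2] <;> ring
    · intro r _ hr
      linear_combination sl2Weight r * sl2Weight q * splitInd_mul_adjSwap_comm K hr f τ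
    · simp
  rw [Finset.sum_congr rfl fun q _ => diag q, ← Finset.sum_mul,
    sum_sl2Weight_mul_sub fun q => if τ.symm q ∈ K then 1 else 0, ← Equiv.sum_comp τ]
  congr 1
  simp only [Equiv.symm_apply_apply, mul_ite, mul_one, mul_zero, Finset.sum_ite_mem,
    Finset.univ_inter, Finset.sum_sub_distrib, ← Finset.mul_sum, blockSum]
  simp [Finset.mul_sum]

theorem sum_comp_adjSwap_sub {M : Type*} [CommRing M] (b : Fin (n + 1) → M) (w : Fin (n + 1) → M)
    (r : Fin n) (τ : Perm (Fin (n + 1))) :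
    ∑ m, b m * w (τ m) - ∑ m, b m * w ((adjSwap r * τ) m) =
      (b (τ.symm r.succ) - b (τ.symm r.castSucc)) * (w r.succ - w r.castSucc) := by
  have hne : r.succ ≠ r.castSucc := (Fin.castSucc_lt_succ).ne'
  rw [← Equiv.sum_comp τ.symm, ← Equiv.sum_comp τ.symm (fun m => b m * w ((adjSwap r * τ) m)),
    ← Finset.sum_sub_distrib]
  simp only [Perm.mul_apply, Equiv.apply_symm_apply]
  rw [← Finset.sum_subset (Finset.subset_univ {r.succ, r.castSucc}), Finset.sum_pair hne,
    adjSwap_succ, adjSwap_castSucc]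
  · ring
  · intro x _ hx
    simp only [Finset.mem_insert, Finset.mem_singleton, not_or] at hx
    rw [adjSwap, swap_apply_of_ne_of_ne hx.2 hx.1, sub_self]

theorem blockSum_cast (τ : Perm (Fin (n + 1))) :
    (blockSum K τ : ℤ) = ∑ m, (if m ∈ K then 1 else 0) * ((τ m : ℕ) : ℤ) := by
  simp [blockSum]

theorem blockSum_adjSwap_mul (r : Fin n) (τ : Perm (Fin (n + 1))) (h1 : τ.symm r.succ ∈ K)
    (h2 : τ.symm r.castSucc ∉ K) : blockSum K τ = blockSum K (adjSwap r * τ) + 1 := by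
  have := sum_comp_adjSwap_sub (fun m => if m ∈ K then (1 : ℤ) else 0) (fun q => ((q : ℕ) : ℤ)) r τ
  rw [← blockSum_cast, ← blockSum_cast] at this
  simp only [h1, h2, if_true, if_false, Fin.val_succ, Fin.val_castSucc] at this
  push_cast at this
  omega

theorem exists_of_raiseOp_ne_zero {f : Perm (Fin (n + 1)) → ℝ} {τ : Perm (Fin (n + 1))}
    (h : raiseOp K f τ ≠ 0) :
    ∃ r : Fin n, τ.symm r.succ ∈ K ∧ τ.symm r.castSucc ∉ K ∧ f (adjSwap r * τ) ≠ 0 := by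
  obtain ⟨r, -, hr⟩ := Finset.exists_ne_zero_of_sum_ne_zero ((raiseOp_apply K f τ).symm.trans_ne h)
  have hr1 := right_ne_zero_of_mul hr
  have hr2 := right_ne_zero_of_mul (left_ne_zero_of_mul hr)
  simp only [splitInd, ne_eq, ite_eq_right_iff, one_ne_zero, imp_false, not_not] at hr2
  exact ⟨r, hr2.1, hr2.2, hr1⟩

theorem exists_of_lowerOp_ne_zero {f : Perm (Fin (n + 1)) → ℝ} {τ : Perm (Fin (n + 1))}
    (h : lowerOp K f τ ≠ 0) :
    ∃ r : Fin n, τ.symm r.castSucc ∈ K ∧ τ.symm r.succ ∉ K ∧ f (adjSwap r * τ) ≠ 0 := by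
  obtain ⟨r, -, hr⟩ := Finset.exists_ne_zero_of_sum_ne_zero ((lowerOp_apply K f τ).symm.trans_ne h)
  have hr1 := right_ne_zero_of_mul hr
  have hr2 := right_ne_zero_of_mul (left_ne_zero_of_mul hr)
  simp only [splitInd, ne_eq, ite_eq_right_iff, one_ne_zero, imp_false, not_not] at hr2
  exact ⟨r, hr2.1, hr2.2, hr1⟩

/-- Rotating the values shows that the residues of `blockSum` modulo a prime are equidistributed. -/
theorem card_blockSum_eq_le (hp : (n + 1).Prime) (hK0 : 0 < K.card) (hK : K.card < n + 1) (h : ℕ) :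
    Fintype.card {τ // blockSum K τ = h} ≤ n.factorial := by
  have : Fact (n + 1).Prime := ⟨hp⟩
  let φ : Perm (Fin (n + 1)) → ZMod (n + 1) := fun τ => ∑ m ∈ K, show ZMod (n + 1) from τ m
  have hφ (τ : Perm (Fin (n + 1))) : φ τ = (blockSum K τ : ZMod (n + 1)) := by
    simp only [φ, blockSum, Nat.cast_sum]
    exact Finset.sum_congr rfl fun m _ => (ZMod.natCast_zmod_val (n := n + 1) (τ m)).symm
  have hk : (K.card : ZMod (n + 1)) ≠ 0 := by
    rw [Ne, ZMod.natCast_eq_zero_iff]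
    exact Nat.not_dvd_of_pos_of_lt hK0 hK
  have fiber_le (c d : ZMod (n + 1)) :
      #{τ | φ τ = c} ≤ #{τ | φ τ = d} := by
    let e : Perm (Fin (n + 1)) :=
      show Perm (ZMod (n + 1)) from Equiv.addRight ((d - c) / K.card)
    refine Finset.card_le_card_of_injOn (fun τ => e * τ) ?_
      fun x _ y _ hxy => mul_left_cancel hxy
    intro τ hτ
    simp only [Finset.coe_filter, Finset.mem_univ, true_and, Set.mem_ofPred_eq] at hτ ⊢
    have he : φ (e * τ) =
        ∑ m ∈ K, ((show ZMod (n + 1) from τ m) + (d - c) / (K.card : ZMod (n + 1))) := rfl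
    rw [he, Finset.sum_add_distrib, Finset.sum_const, nsmul_eq_mul, mul_div_cancel₀ _ hk]
    change φ τ + (d - c) = d
    rw [hτ]
    ring
  have total : (n + 1) * #{τ | φ τ = (h : ZMod (n + 1))} = (n + 1).factorial := by
    have h1 := Finset.card_eq_sum_card_fiberwise (f := φ) (s := univ) (t := univ)
      fun x _ => Finset.mem_coe.2 (Finset.mem_univ _)
    rw [Finset.sum_congr rfl fun c _ => le_antisymm (fiber_le c h) (fiber_le h c),
      Finset.sum_const, Finset.card_univ, Finset.card_univ, ZMod.card, Fintype.card_perm,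
      Fintype.card_fin, smul_eq_mul] at h1
    exact h1.symm
  rw [Nat.factorial_succ] at total
  rw [← Nat.eq_of_mul_eq_mul_left n.succ_pos total, Fintype.card_subtype]
  refine Finset.card_le_card fun τ hτ => ?_
  simp only [Finset.mem_filter, Finset.mem_univ, true_and] at hτ ⊢
  rw [hφ, hτ]

theorem card_perm_sum_eq_zero_le (hp : (n + 1).Prime) (a w : Fin (n + 1) → ℝ) (hw : StrictMono w)
    {i j : Fin (n + 1)} (hij : a i < a j) :
    Fintype.card {τ : Perm (Fin (n + 1)) // ∑ m, a m * w (τ m) = 0} ≤ n.factorial := by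
  classical
  let K : Finset (Fin (n + 1)) := {m | a i < a m}
  have hjK : j ∈ K := by simpa [K] using hij
  have hiK : i ∉ K := by simp [K]
  have hK : K.card < n + 1 := by
    simpa using Finset.card_lt_univ_of_notMem hiK
  refine le_trans (card_zero_le_card_middle (raiseOp K) (lowerOp K) (blockSum K) (K.card * n)
    (fun τ => ∑ m, a m * w (τ m)) (sum_raiseOp_mul K) (raiseOp_lowerOp_sub K) ?_ ?_)
    (card_blockSum_eq_le K hp (Finset.card_pos.2 ⟨j, hjK⟩) hK _)
  · intro f τ hτ
    obtain ⟨r, h1, h2, h3⟩ := exists_of_raiseOp_ne_zero K hτ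
    refine ⟨adjSwap r * τ, h3, ?_, blockSum_adjSwap_mul K r τ h1 h2⟩
    rw [← sub_pos, sum_comp_adjSwap_sub a w r τ]
    simp only [K, Finset.mem_filter, Finset.mem_univ, true_and, not_lt] at h1 h2
    exact mul_pos (by linarith) (sub_pos.2 (hw Fin.castSucc_lt_succ))
  · intro f τ hτ
    obtain ⟨r, h1, h2, h3⟩ := exists_of_lowerOp_ne_zero K hτ
    refine ⟨adjSwap r * τ, h3, ?_⟩
    have := blockSum_adjSwap_mul K r (adjSwap r * τ)
    rw [adjSwap_mul_adjSwap_mul] at this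
    exact this (by rwa [adjSwap_mul_symm_apply, adjSwap_succ])
      (by rwa [adjSwap_mul_symm_apply, adjSwap_castSucc])

theorem ncard_hyperplane_inter_orbit_le (hp : (n + 1).Prime) (a v : Fin (n + 1) → ℝ)
    (hv : Function.Injective v) {i j : Fin (n + 1)} (hij : a i ≠ a j) :
    ({x : Fin (n + 1) → ℝ | ∑ m, a m * x m = 0} ∩
      {w | ∃ σ : Perm (Fin (n + 1)), w = fun m => v (σ⁻¹ m)}).ncard ≤ n.factorial := by
  classical
  have hw : StrictMono (v ∘ Tuple.sort v) :=
    (Tuple.monotone_sort v).strictMono_of_injective (hv.comp (Tuple.sort v).injective)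
  have hcard : Fintype.card {τ : Perm (Fin (n + 1)) // ∑ m, a m * (v ∘ Tuple.sort v) (τ m) = 0} ≤
      n.factorial := by
    rcases lt_or_gt_of_ne hij with h | h
    · exact card_perm_sum_eq_zero_le hp a _ hw h
    · exact card_perm_sum_eq_zero_le hp a _ hw h
  refine le_trans ?_ hcard
  rw [Fintype.card_subtype, ← Set.ncard_coe_finset]
  refine le_trans (Set.ncard_le_ncard ?_ ((Finset.finite_toSet _).image
    fun τ m => (v ∘ Tuple.sort v) (τ m))) (Set.ncard_image_le (Finset.finite_toSet _))
  rintro x ⟨hx, σ, rfl⟩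
  refine ⟨(Tuple.sort v)⁻¹ * σ⁻¹, ?_, ?_⟩
  · simpa using hx
  · funext m
    simp

end Permutations


/-- Let `p ≥ 5` be prime and `a ∈ ℝ^p`. Suppose there are distinct indices
`i₁,…,i_s` and distinct indices `j₁,…,j_t` with `a` constant on the `i`'s, constant on the
`j`'s, `a_{i₁} ≠ a_{j₁}`, and `s·t ≥ p - 1`. Then for every `v ∈ ℝ^p` with pairwise distinct
coordinates, the hyperplane `H = {x | ∑ m, a m * x m = 0}` satisfies `|H ∩ Sₚ·v| ≤ (p-1)!`. -/
theorem stmt10 (p : ℕ) (hp : p.Prime) (hp5 : 5 ≤ p)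
    (a : Fin p → ℝ) (s t : ℕ) (hs : 0 < s) (ht : 0 < t)
    (I : Fin s → Fin p) (hI : Function.Injective I)
    (J : Fin t → Fin p) (hJ : Function.Injective J)
    (haI : ∀ x y : Fin s, a (I x) = a (I y))
    (haJ : ∀ x y : Fin t, a (J x) = a (J y))
    (hIJ : a (I ⟨0, hs⟩) ≠ a (J ⟨0, ht⟩))
    (hst : p - 1 ≤ s * t)
    (v : Fin p → ℝ) (hv : ∀ i j : Fin p, i ≠ j → v i ≠ v j) :
    ({x : Fin p → ℝ | ∑ m, a m * x m = 0} ∩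
      {w : Fin p → ℝ | ∃ σ : Equiv.Perm (Fin p), w = fun m => v (σ⁻¹ m)}).ncard
      ≤ (p - 1).factorial := by
  obtain ⟨n, rfl⟩ : ∃ n, p = n + 1 := ⟨p - 1, by omega⟩
  exact ncard_hyperplane_inter_orbit_le hp a v
    (fun i j h => by_contra fun hij => hv i j hij h) hIJ
end
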